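/- arXiv:1609.03263 — 13 statements merged into one kernel-verified Lean document; each statement's English description precedes it below -/
import Mathlib

section
/- For any cycle number u and any positive integer n, there exist n consecutive u-integers; that is, there exists a positive integer l such that l+1, l+2, ..., l+n are all u-integers. -/
def CU.G (f : ℕ → ℕ) (u : ℕ) (S : Finset ℕ) : Prop :=
  ∃ l r : ℕ, 1 ≤ r ∧ ∀ x ∈ S, f^[r] (l + x) = u

theorem CU.add_digit (b : ℕ) (hb : 2 ≤ b) (fstar f : ℕ → ℕ)
    (hf : ∀ n, f n = ((Nat.digits b n).map fstar).sum) (h0 : fstar 0 = 0)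
    (a y : ℕ) (ha : a < b) : f (a + b * y) = fstar a + f y := by
  by_cases h : a = 0 ∧ y = 0
  · obtain ⟨rfl, rfl⟩ := h
    simp [hf, h0]
  · rw [hf, hf, Nat.digits_add b (by omega) a y ha (by omega)]
    simp

theorem CU.add_block (b : ℕ) (hb : 2 ≤ b) (fstar f : ℕ → ℕ)
    (hf : ∀ n, f n = ((Nat.digits b n).map fstar).sum) (h0 : fstar 0 = 0) (K : ℕ) :
    ∀ x y : ℕ, x < b ^ K → f (x + b ^ K * y) = f x + f y := by
  induction K with
  | zero =>
    intro x y hx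
    have : x = 0 := by simpa using hx
    subst this
    simp [hf]
  | succ K ih =>
    intro x y hx
    have hb0 : 0 < b := by omega
    have h2 : x / b < b ^ K := by
      rw [Nat.div_lt_iff_lt_mul hb0]; rwa [pow_succ] at hx
    have e1 : x + b ^ (K+1) * y = x % b + b * (x / b + b ^ K * y) := by
      have := Nat.mod_add_div x b
      rw [pow_succ]; nlinarith
    have e2 : f x = fstar (x % b) + f (x / b) := by
      conv_lhs => rw [← Nat.mod_add_div x b]
      exact CU.add_digit b hb fstar f hf h0 _ _ (Nat.mod_lt _ hb0)
    rw [e1, CU.add_digit b hb fstar f hf h0 _ _ (Nat.mod_lt _ hb0), ih _ _ h2, e2]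
    ring


theorem CU.shift (b : ℕ) (hb : 2 ≤ b) (f : ℕ → ℕ) (h0 : f 0 = 0)
    (hB : ∀ K x y : ℕ, x < b ^ K → f (x + b ^ K * y) = f x + f y) (K y : ℕ) :
    f (b ^ K * y) = f y := by
  have := hB K 0 y (by positivity)
  simpa [h0] using this

theorem CU.ones (b : ℕ) (hb : 2 ≤ b) (f : ℕ → ℕ) (h0 : f 0 = 0) (h1 : f 1 = 1)
    (hB : ∀ K x y : ℕ, x < b ^ K → f (x + b ^ K * y) = f x + f y) (s : ℕ) :
    ∃ y, f y = s := by
  induction s with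
  | zero => exact ⟨0, h0⟩
  | succ s ih =>
    obtain ⟨y, hy⟩ := ih
    refine ⟨y + b ^ y * 1, ?_⟩
    rw [hB _ _ _ (Nat.lt_pow_self (by omega)), hy, h1]

theorem CU.nines (b : ℕ) (hb : 2 ≤ b) (f : ℕ → ℕ) (h0 : f 0 = 0)
    (hB : ∀ K x y : ℕ, x < b ^ K → f (x + b ^ K * y) = f x + f y) (K : ℕ) :
    f (b ^ K - 1) = K * f (b - 1) := by
  induction K with
  | zero => simp [h0]
  | succ K ih =>
    have hp : 0 < b ^ K := by positivity
    have : b ^ (K+1) - 1 = (b ^ K - 1) + b ^ K * (b - 1) := by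
      obtain ⟨a, rfl⟩ : ∃ a, b = a + 1 := ⟨b - 1, by omega⟩
      rw [pow_succ]
      simp only [Nat.add_sub_cancel]
      have : (a+1)^K * (a+1) = (a+1)^K * a + (a+1)^K := by ring
      omega
    rw [this, hB _ _ _ (by omega), ih]; ring

/-- append `n` copies of the digit `a` -/
theorem CU.copies (b : ℕ) (hb : 2 ≤ b) (f : ℕ → ℕ)
    (hB : ∀ K x y : ℕ, x < b ^ K → f (x + b ^ K * y) = f x + f y)
    (c : ℕ) (hc : Nat.Coprime b c) (hc0 : 0 < c) (a y n : ℕ) :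
    ∃ z, f z = f y + n * f a ∧ z ≡ y + n * a [MOD c] := by
  induction n with
  | zero => exact ⟨y, by simp, by simp; rfl⟩
  | succ n ih =>
    obtain ⟨z, hz, hz'⟩ := ih
    refine ⟨z + b ^ (c.totient * z) * a, ?_, ?_⟩
    · rw [hB, hz]; · ring
      calc z < b ^ z := Nat.lt_pow_self (by omega)
        _ ≤ _ := Nat.pow_le_pow_right (by omega)
            (Nat.le_mul_of_pos_left _ (Nat.totient_pos.2 hc0))
    · have h : b ^ (c.totient * z) ≡ 1 [MOD c] := by
        rw [pow_mul]
        simpa using (Nat.ModEq.pow_totient hc).pow z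
      have := hz'.add (h.mul_right a)
      refine this.trans ?_
      have e : y + n * a + 1 * a = y + (n+1) * a := by ring
      rw [e]

theorem CU.key (b : ℕ) (hb : 2 ≤ b) (f : ℕ → ℕ) (h0 : f 0 = 0) (h1 : f 1 = 1)
    (hB : ∀ K x y : ℕ, x < b ^ K → f (x + b ^ K * y) = f x + f y)
    (c : ℕ) (hc : Nat.Coprime b c) (hc0 : 0 < c) (m : ℕ)
    (hm : IsCoprime ((f m : ℤ) - m) (c : ℤ)) (e N : ℕ) :
    ∃ D M, N ≤ D ∧ c ∣ D + e ∧ f D + 1 = b ^ M := by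
  obtain ⟨w, v, hwv⟩ := hm
  have hcz : (0:ℤ) < c := by exact_mod_cast hc0
  obtain ⟨α, hα⟩ : ∃ α : ℕ, (α : ℤ) = (w * e) % c :=
    ⟨((w * e) % c).toNat, Int.toNat_of_nonneg (Int.emod_nonneg _ hcz.ne')⟩
  have hT : 0 < c.totient := Nat.totient_pos.2 hc0
  have hmod : ∀ k, b ^ (c.totient * k) ≡ 1 [MOD c] := fun k => by
    rw [pow_mul]; simpa using (Nat.ModEq.pow_totient hc).pow k
  set M := c.totient * (α * f m + 1) with hM
  have hlt : α * f m + 1 < b ^ M := by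
    calc α * f m + 1 < b ^ (α * f m + 1) := Nat.lt_pow_self (by omega)
      _ ≤ _ := Nat.pow_le_pow_right (by omega) (Nat.le_mul_of_pos_left _ hT)
  obtain ⟨β, hβ⟩ : ∃ β, α * f m + 1 + β = b ^ M := ⟨b ^ M - (α * f m + 1), by omega⟩
  obtain ⟨y, hy, hy'⟩ := CU.copies b hb f hB c hc hc0 m 0 α
  obtain ⟨z, hz, hz'⟩ := CU.copies b hb f hB c hc hc0 1 y β
  rw [hy, h0, h1] at hz
  have hfz : f z + 1 = b ^ M := by rw [hz, ← hβ]; ring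
  have hz0 : 0 < z := by
    rcases Nat.eq_zero_or_pos z with h | h
    · rw [h, h0] at hfz; omega
    · exact h
  refine ⟨b ^ (c.totient * N) * z, M, ?_, ?_, ?_⟩
  · calc N ≤ b ^ N := (Nat.lt_pow_self (by omega)).le
      _ ≤ b ^ (c.totient * N) := Nat.pow_le_pow_right (by omega) (Nat.le_mul_of_pos_left _ hT)
      _ ≤ _ := Nat.le_mul_of_pos_right _ hz0
  · have q1 : b ^ (c.totient * N) * z ≡ α * m + β [MOD c] := by
      have := ((hmod N).mul_right z)
      rw [one_mul] at this
      refine this.trans (hz'.trans ?_)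
      have := hy'.add_right (β * 1)
      simpa using this
    have q2 := hmod (α * f m + 1)
    rw [← hM, ← hβ] at q2
    have r1 := (Nat.modEq_iff_dvd.1 q1)
    have r2 := (Nat.modEq_iff_dvd.1 q2)
    have r3 : (c:ℤ) ∣ w * e - α := by rw [hα]; exact Int.dvd_self_sub_emod
    push_cast at r1 r2
    zify
    obtain ⟨k1, e1⟩ := r1
    obtain ⟨k2, e2⟩ := r2
    obtain ⟨k3, e3⟩ := r3
    push_cast
    refine ⟨-k1 - k2 + v * e + k3 * (f m - m), ?_⟩
    linear_combination (-1) * e1 - e2 + (f m - m) * e3 - (e:ℤ) * hwv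
  · rw [CU.shift b hb f h0 hB, hfz]

theorem CU.G_add (f : ℕ → ℕ) (u t : ℕ) (S : Finset ℕ)
    (h : CU.G f u (S.image (· + t))) : CU.G f u S := by
  obtain ⟨l, r, hr, h⟩ := h
  refine ⟨l + t, r, hr, fun x hx => ?_⟩
  have := h (x + t) (Finset.mem_image_of_mem _ hx)
  rwa [show l + t + x = l + (x + t) by ring]

theorem CU.G_f (b : ℕ) (hb : 2 ≤ b) (f : ℕ → ℕ) (h0 : f 0 = 0) (h1 : f 1 = 1)
    (hB : ∀ K x y : ℕ, x < b ^ K → f (x + b ^ K * y) = f x + f y) (u : ℕ) (S : Finset ℕ)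
    (h : CU.G f u (S.image f)) : CU.G f u S := by
  obtain ⟨l, r, hr, h⟩ := h
  obtain ⟨y, hy⟩ := CU.ones b hb f h0 h1 hB l
  refine ⟨b ^ (S.sup id) * y, r + 1, by omega, fun x hx => ?_⟩
  have hx' : x ≤ S.sup id := Finset.le_sup (f := id) hx
  rw [Function.iterate_succ_apply, add_comm, hB, hy, add_comm]
  · exact h _ (Finset.mem_image_of_mem _ hx)
  · exact hx'.trans_lt (Nat.lt_pow_self (by omega))

theorem CU.pair (b : ℕ) (hb : 2 ≤ b) (f : ℕ → ℕ) (h0 : f 0 = 0) (h1 : f 1 = 1)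
    (hB : ∀ K x y : ℕ, x < b ^ K → f (x + b ^ K * y) = f x + f y)
    (hc : Nat.Coprime b (f (b-1))) (m : ℕ)
    (hm : IsCoprime ((f m : ℤ) - m) (f (b-1) : ℤ)) (x y : ℕ) (hxy : x < y) :
    ∃ t s, f (f (f (x + t) + s)) = f (f (f (y + t) + s)) := by
  have hc0 : 0 < f (b-1) := by
    rcases Nat.eq_zero_or_pos (f (b-1)) with h | h
    · rw [h] at hc; simp at hc; omega
    · exact h
  obtain ⟨d, rfl⟩ : ∃ d, y = x + (d + 1) := ⟨y - x - 1, by omega⟩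
  obtain ⟨D, M, hN, ⟨K, hK⟩, hD⟩ :=
    CU.key b hb f h0 h1 hB (f (b-1)) hc hc0 m hm (1 + f d) (f (b-1) * (x + d))
  have hKx : x + d ≤ K := by
    have : f (b-1) * (x+d) ≤ f (b-1) * K := by omega
    exact Nat.le_of_mul_le_mul_left this hc0
  have hKb : x + d < b ^ K := hKx.trans_lt (Nat.lt_pow_self (by omega))
  have e1 : x + (b ^ K - 1 - x) = b ^ K - 1 := by omega
  have e2 : x + (d + 1) + (b ^ K - 1 - x) = d + b ^ K * 1 := by omega
  have f1 : f (x + (b ^ K - 1 - x)) = D + (1 + f d) := by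
    rw [e1, CU.nines b hb f h0 hB, hK, mul_comm]
  have f2 : f (x + (d + 1) + (b ^ K - 1 - x)) = 1 + f d := by
    rw [e2, hB _ _ _ (by omega), h1, add_comm]
  have hL : D + (1 + f d) < b ^ (D + (1 + f d)) := Nat.lt_pow_self (by omega)
  refine ⟨b ^ K - 1 - x, b ^ (D + (1 + f d)) - (1 + f d), ?_⟩
  rw [f1, f2]
  have e3 : D + (1 + f d) + (b ^ (D + (1 + f d)) - (1 + f d)) = D + b ^ (D + (1 + f d)) * 1 := by
    omega
  have e4 : (1 + f d) + (b ^ (D + (1 + f d)) - (1 + f d)) = b ^ (D + (1 + f d)) * 1 := by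
    omega
  rw [e3, e4, hB _ _ _ (by omega), CU.shift b hb f h0 hB, h1, hD, h1]
  have := CU.shift b hb f h0 hB M 1
  rwa [mul_one, h1] at this

theorem CU.G_all (b : ℕ) (hb : 2 ≤ b) (f : ℕ → ℕ) (h0 : f 0 = 0) (h1 : f 1 = 1)
    (hB : ∀ K x y : ℕ, x < b ^ K → f (x + b ^ K * y) = f x + f y)
    (hc : Nat.Coprime b (f (b-1))) (m : ℕ)
    (hm : IsCoprime ((f m : ℤ) - m) (f (b-1) : ℤ))
    (u : ℕ) (hu : 0 < u) (hcyc : ∃ r : ℕ, 1 ≤ r ∧ f^[r] u = u) (n : ℕ) :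
    ∀ S : Finset ℕ, S.card ≤ n → CU.G f u S := by
  induction n with
  | zero =>
    intro S hS
    have : S = ∅ := by simpa using hS
    subst this
    exact ⟨0, 1, le_rfl, by simp⟩
  | succ n ih =>
    intro S hS
    by_cases h : ∃ x ∈ S, ∃ y ∈ S, x < y
    · obtain ⟨x, hx, y, hy, hxy⟩ := h
      obtain ⟨t, s, hts⟩ := CU.pair b hb f h0 h1 hB hc m hm x y hxy
      apply CU.G_add f u t
      apply CU.G_f b hb f h0 h1 hB
      apply CU.G_add f u s
      apply CU.G_f b hb f h0 h1 hB
      apply CU.G_f b hb f h0 h1 hB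
      apply ih
      simp only [Finset.image_image]
      by_contra hcon
      have hle : S.card ≤ (Finset.image (f ∘ f ∘ (· + s) ∘ f ∘ (· + t)) S).card := by
        omega
      have hinj := Finset.card_image_iff.1 (le_antisymm Finset.card_image_le hle)
      have := hinj hx hy (by simpa using hts)
      omega
    · push Not at h
      obtain ⟨r, hr, hru⟩ := hcyc
      obtain rfl | ⟨x, hx⟩ := S.eq_empty_or_nonempty
      · exact ⟨0, 1, le_rfl, by simp⟩
      refine ⟨b ^ x * u - x, r, hr, fun z hz => ?_⟩
      have hzx : z = x := le_antisymm (h x hx z hz) (h z hz x hx)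
      subst hzx
      have : z ≤ b ^ z * u :=
        (Nat.lt_pow_self (by omega)).le.trans (Nat.le_mul_of_pos_right _ hu)
      rw [Nat.sub_add_cancel this]
      obtain ⟨r, rfl⟩ : ∃ k, r = k + 1 := ⟨r - 1, by omega⟩
      rw [Function.iterate_succ_apply, CU.shift b hb f h0 hB, ← Function.iterate_succ_apply, hru]


/-- For any cycle number `u` and any positive integer `n`, there exist
`n` consecutive `u`-integers. -/
theorem stmt_0 (b : ℕ) (hb : 2 ≤ b) (fstar : ℕ → ℕ) (f : ℕ → ℕ)
    (hf : ∀ n, f n = ((Nat.digits b n).map fstar).sum)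
    (h0 : fstar 0 = 0) (h1 : fstar 1 = 1)
    (hgcd : Nat.gcd b (fstar (b - 1)) = 1)
    (hm : ∃ mstar : ℕ, mstar ≤ b - 1 ∧
      Int.gcd ((fstar mstar : ℤ) - (mstar : ℤ)) (fstar (b - 1) : ℤ) = 1)
    (u : ℕ) (hu : 0 < u) (hcyc : ∃ r : ℕ, 1 ≤ r ∧ f^[r] u = u)
    (n : ℕ) (hn : 0 < n) :
    ∃ l : ℕ, 0 < l ∧ ∀ i : ℕ, 1 ≤ i → i ≤ n → ∃ r : ℕ, 1 ≤ r ∧ f^[r] (l + i) = u := by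
  have hB := CU.add_block b hb fstar f hf h0
  have f0 : f 0 = 0 := by simp [hf]
  have hd : ∀ a < b, f a = fstar a := fun a ha => by
    have := CU.add_digit b hb fstar f hf h0 a 0 ha
    simpa [f0] using this
  have f1 : f 1 = 1 := by rw [hd 1 (by omega), h1]
  obtain ⟨m, hmb, hm⟩ := hm
  rw [← hd (b-1) (by omega)] at hgcd hm
  rw [← hd m (by omega)] at hm
  obtain ⟨l, r, hr, h⟩ := CU.G_all b hb f f0 f1 (fun K => hB K) hgcd m
    (Int.isCoprime_iff_gcd_eq_one.2 hm) u hu hcyc _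
    ((Finset.Icc 1 n).image (· + 1)) le_rfl
  refine ⟨l + 1, by omega, fun i h1 h2 => ⟨r, hr, ?_⟩⟩
  have := h (i + 1) (Finset.mem_image_of_mem _ (Finset.mem_Icc.2 ⟨h1, h2⟩))
  rwa [show l + 1 + i = l + (i + 1) by ring]
end

section
/- Let x and m be arbitrary positive integers. Then for each integer r ≥ 1, there exists a positive integer l such that f^r(l) = x and f^r(l+y) = f^r(l) + f^r(y) = x + f^r(y) for every y with 1 ≤ y ≤ m. -/
theorem stmt_1_aux (b : ℕ) (hb : 2 ≤ b) (fstar : ℕ → ℕ) (f : ℕ → ℕ)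
    (hf : ∀ n, f n = ((Nat.digits b n).map fstar).sum)
    (h0 : fstar 0 = 0) (h1 : fstar 1 = 1) (r : ℕ) :
    ∀ x m : ℕ, ∃ l : ℕ, ∀ y ≤ m, f^[r] (l + y) = x + f^[r] y := by
  have f0 : f 0 = 0 := by simp [hf]
  have rec1 : ∀ n, f n = fstar (n % b) + f (n / b) := by
    intro n
    rcases Nat.eq_zero_or_pos n with rfl | hn
    · simp [f0, h0]
    · rw [hf n, Nat.digits_def' (by omega) hn, hf (n / b)]
      simp
  have split : ∀ k q y, y < b ^ k → f (b ^ k * q + y) = f q + f y := by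
    intro k
    induction k with
    | zero =>
      intro q y hy
      have : y = 0 := by simpa using hy
      subst this
      simp [f0]
    | succ k ih =>
      intro q y hy
      have e : b ^ (k+1) * q + y = y + b * (b ^ k * q) := by ring
      have hy' : y / b < b ^ k := by
        apply Nat.div_lt_of_lt_mul
        rwa [pow_succ, mul_comm] at hy
      rw [e, rec1 (y + _), Nat.add_mul_mod_self_left, Nat.add_mul_div_left _ _ (by omega),
        add_comm (y / b), ih _ _ hy', rec1 y]
      ring
  have surj : ∀ n, ∃ q, f q = n := by
    intro n
    induction n with
    | zero => exact ⟨0, f0⟩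
    | succ n ih =>
      obtain ⟨q, hq⟩ := ih
      refine ⟨b ^ 1 * q + 1, ?_⟩
      rw [split 1 q 1 (by simp; omega), hq, rec1 1, Nat.mod_eq_of_lt (by omega),
        Nat.div_eq_of_lt (by omega), h1, f0]
  induction r with
  | zero => exact fun x m => ⟨x, fun y _ => rfl⟩
  | succ r ih =>
    intro x m
    obtain ⟨l', hl'⟩ := ih x (∑ y ∈ Finset.range (m+1), f y)
    obtain ⟨q, hq⟩ := surj l'
    refine ⟨b ^ m * q, fun y hy => ?_⟩
    rw [Function.iterate_succ_apply, Function.iterate_succ_apply,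
      split m q y (lt_of_le_of_lt hy (Nat.lt_pow_self (by omega))), hq]
    exact hl' _ (Finset.single_le_sum (f := f) (fun _ _ => Nat.zero_le _)
      (Finset.mem_range.2 (by omega)))

/-- For arbitrary positive integers `x`, `m` and each `r ≥ 1`, there
exists a positive integer `l` with `f^[r] l = x` and
`f^[r] (l + y) = f^[r] l + f^[r] y = x + f^[r] y` for all `1 ≤ y ≤ m`. -/
theorem stmt_1 (b : ℕ) (hb : 2 ≤ b) (fstar : ℕ → ℕ) (f : ℕ → ℕ)
    (hf : ∀ n, f n = ((Nat.digits b n).map fstar).sum)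
    (h0 : fstar 0 = 0) (h1 : fstar 1 = 1)
    (x m : ℕ) (hx : 0 < x) (hm : 0 < m) (r : ℕ) (hr : 1 ≤ r) :
    ∃ l : ℕ, 0 < l ∧ f^[r] l = x ∧
      ∀ y : ℕ, 1 ≤ y → y ≤ m →
        f^[r] (l + y) = f^[r] l + f^[r] y ∧ f^[r] (l + y) = x + f^[r] y := by
  obtain ⟨l, hl⟩ := stmt_1_aux b hb fstar f hf h0 h1 r x m
  have f0 : f 0 = 0 := by simp [hf]
  have fr : f^[r] 0 = 0 := Function.iterate_fixed f0 r
  have hlx : f^[r] l = x := by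
    have := hl 0 (Nat.zero_le _)
    rwa [fr, add_zero, add_zero] at this
  refine ⟨l, ?_, hlx, fun y _ hy => ⟨by rw [hlx]; exact hl y hy, hl y hy⟩⟩
  rcases Nat.eq_zero_or_pos l with rfl | h
  · omega
  · exact h
end

section
/- The set D of all cycle numbers of f is finite; that is, the set of positive integers n for which there exists r ≥ 1 with f^r(n) = n is a finite set. -/
/-- The set `D` of all cycle numbers of `f` is finite. -/
theorem stmt_2 (b : ℕ) (hb : 2 ≤ b) (fstar : ℕ → ℕ) (f : ℕ → ℕ)
    (hf : ∀ n, f n = ((Nat.digits b n).map fstar).sum) :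
    {n : ℕ | 0 < n ∧ ∃ r : ℕ, 1 ≤ r ∧ f^[r] n = n}.Finite := by
  obtain ⟨M, hM⟩ : ∃ M, ∀ d < b, fstar d ≤ M :=
    ⟨∑ d ∈ Finset.range b, fstar d, fun d hd =>
      Finset.single_le_sum (f := fstar) (fun _ _ => Nat.zero_le _) (Finset.mem_range.2 hd)⟩
  have hle : ∀ n, f n ≤ (Nat.digits b n).length * M := by
    intro n
    rw [hf]
    have := List.sum_le_card_nsmul ((Nat.digits b n).map fstar) M (by
      intro x hx
      obtain ⟨d, hd, rfl⟩ := List.mem_map.1 hx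
      exact hM d (Nat.digits_lt_base (by omega) hd))
    simpa using this
  have hdec : ∀ n, b ^ (4 * M + 2) ≤ n → f n < n := by
    intro n hn
    have hn0 : n ≠ 0 := by
      have : 0 < b ^ (4 * M + 2) := by positivity
      omega
    have h1 : 4 * M + 2 ≤ Nat.log b n := Nat.le_log_of_pow_le (by omega) hn
    have h2 : b ^ Nat.log b n ≤ n := Nat.pow_log_le_self b hn0
    have h3 := hle n
    rw [Nat.length_digits b n (by omega) hn0] at h3
    generalize Nat.log b n = l at *
    obtain ⟨a, ha⟩ : ∃ a, a = l / 2 := ⟨_, rfl⟩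
    have h4 : 2 ^ (a + a) ≤ n := calc
      2 ^ (a + a) ≤ 2 ^ l := Nat.pow_le_pow_right (by omega) (by omega)
      _ ≤ b ^ l := Nat.pow_le_pow_left hb l
      _ ≤ n := h2
    have h5 : a + 1 ≤ 2 ^ a := Nat.lt_two_pow_self
    rw [pow_add] at h4
    have h6 : (a + 1) * (a + 1) ≤ n := le_trans (Nat.mul_le_mul h5 h5) h4
    have h7 : (l + 1) * M ≤ (2 * a + 2) * M := Nat.mul_le_mul_right _ (by omega)
    have h8 : 2 * M < a + 1 := by omega
    nlinarith
  generalize b ^ (4 * M + 2) = N at hdec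
  refine (Set.finite_Iic (N + ∑ d ∈ Finset.range N, f d)).subset ?_
  rintro n ⟨-, r, hr, hrn⟩
  rw [Set.mem_Iic]
  by_contra! hlt
  have key : ∀ i, f^[i + 1] n < n := by
    intro i
    induction i with
    | zero => exact hdec n (by omega)
    | succ i ih =>
      rw [Function.iterate_succ_apply']
      generalize f^[i + 1] n = y at *
      by_cases hy : y < N
      · have := Finset.single_le_sum (f := f) (fun _ _ => Nat.zero_le _) (Finset.mem_range.2 hy)
        omega
      · have := hdec y (by omega)
        omega
  have := key (r - 1)
  rw [Nat.sub_add_cancel hr] at this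
  omega
end

section
/- Every positive integer eventually ends up in a cycle under iterates of f: for every positive integer n, there exists an integer r ≥ 1 such that f^r(n) is a cycle number, i.e., there exist r ≥ 1 and s ≥ 1 with f^{r+s}(n) = f^r(n). -/
/-- Every positive integer eventually ends up in a cycle under
iterates of `f`. -/
theorem stmt_3 (b : ℕ) (hb : 2 ≤ b) (fstar : ℕ → ℕ) (f : ℕ → ℕ)
    (hf : ∀ n, f n = ((Nat.digits b n).map fstar).sum)
    (n : ℕ) (hn : 0 < n) :
    ∃ r : ℕ, 1 ≤ r ∧ ∃ s : ℕ, 1 ≤ s ∧ f^[r + s] n = f^[r] n := by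
  obtain ⟨M, hM⟩ : ∃ M, ∀ d < b, fstar d ≤ M :=
    ⟨∑ d ∈ Finset.range b, fstar d, fun d hd =>
      Finset.single_le_sum (f := fstar) (fun _ _ => Nat.zero_le _) (Finset.mem_range.2 hd)⟩
  obtain ⟨L, hnL, hML⟩ : ∃ L, n < b ^ L ∧ L * M < b ^ L := by
    have h1 : M + n < 2 ^ (M + n) := Nat.lt_two_pow_self
    refine ⟨2 * 2 ^ (M + n), ?_, ?_⟩
    · calc n < 2 * 2 ^ (M + n) := by omega
        _ < 2 ^ (2 * 2 ^ (M + n)) := Nat.lt_two_pow_self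
        _ ≤ _ := Nat.pow_le_pow_left hb _
    · calc 2 * 2 ^ (M + n) * M < 2 * 2 ^ (M + n) * 2 ^ (M + n) :=
            Nat.mul_lt_mul_of_pos_left (by omega) (by positivity)
        _ = 2 ^ (2 * (M + n) + 1) := by ring
        _ ≤ 2 ^ (2 * 2 ^ (M + n)) := Nat.pow_le_pow_right (by norm_num) (by omega)
        _ ≤ _ := Nat.pow_le_pow_left hb _
  have hstep : ∀ m < b ^ L, f m < b ^ L := by
    intro m hm
    have hlen : (Nat.digits b m).length ≤ L := (Nat.digits_length_le_iff (by omega) m).2 hm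
    have hs := List.sum_le_card_nsmul ((Nat.digits b m).map fstar) M (by
      intro x hx
      obtain ⟨d, hd, rfl⟩ := List.mem_map.1 hx
      exact hM d (Nat.digits_lt_base (by omega) hd))
    rw [← hf, List.length_map, smul_eq_mul] at hs
    exact lt_of_le_of_lt (hs.trans (Nat.mul_le_mul_right M hlen)) hML
  have hall : ∀ i, f^[i] n < b ^ L := by
    intro i
    induction i with
    | zero => simpa using hnL
    | succ i ih => rw [Function.iterate_succ_apply']; exact hstep _ ih
  obtain ⟨i, j, hij, he⟩ := (Set.finite_Iio (b ^ L)).exists_lt_map_eq_of_forall_mem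
    (f := fun i : ℕ => f^[i + 1] n) (fun i => hall (i + 1))
  refine ⟨i + 1, by omega, j - i, by omega, ?_⟩
  rw [show i + 1 + (j - i) = j + 1 by omega]
  exact he.symm
end

section
/- Let u be a cycle number. Assume that for each x ∈ D there exists a positive integer h_x such that h_x + u and h_x + x are concurrently u-integers. Then there exists a positive integer h such that h + x is a u-integer for every x ∈ D. -/
inductive WW (f : ℕ → ℕ) : (ℕ → ℕ) → Prop
  | one : WW f (fun x => x)
  | app (w : ℕ → ℕ) : WW f w → WW f (fun x => f (w x))
  | tr (h : ℕ) (w : ℕ → ℕ) : WW f w → WW f (fun x => h + w x)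

def Syn (f : ℕ → ℕ) (x y : ℕ) : Prop := ∃ w, WW f w ∧ w x = w y

def Stb (f : ℕ → ℕ) (x y : ℕ) : Prop := ∀ w, WW f w → Syn f (w x) (w y)

theorem WW.comp {f v w : ℕ → ℕ} (hv : WW f v) (hw : WW f w) : WW f (fun x => v (w x)) := by
  induction hv with
  | one => exact hw
  | app v _ ih => exact WW.app _ ih
  | tr h v _ ih => exact WW.tr h _ ih

theorem WW.iter (f : ℕ → ℕ) (s : ℕ) : WW f (fun x => f^[s] x) := by
  induction s with
  | zero => exact WW.one
  | succ s ih =>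
    have := WW.app _ ih
    simpa only [Function.iterate_succ_apply'] using this

theorem Syn.rfl' {f : ℕ → ℕ} (x : ℕ) : Syn f x x := ⟨_, WW.one, rfl⟩

theorem Syn.symm' {f : ℕ → ℕ} {x y : ℕ} (h : Syn f x y) : Syn f y x := by
  obtain ⟨w, hw, e⟩ := h
  exact ⟨w, hw, e.symm⟩

theorem Syn.of {f w : ℕ → ℕ} (hw : WW f w) {x y : ℕ} (h : Syn f (w x) (w y)) : Syn f x y := by
  obtain ⟨v, hv, e⟩ := h
  exact ⟨_, hv.comp hw, e⟩

theorem Stb.rfl' {f : ℕ → ℕ} (x : ℕ) : Stb f x x := fun _ _ => Syn.rfl' _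

theorem Stb.symm' {f : ℕ → ℕ} {x y : ℕ} (h : Stb f x y) : Stb f y x :=
  fun w hw => (h w hw).symm'

theorem Stb.map {f w : ℕ → ℕ} (hw : WW f w) {x y : ℕ} (h : Stb f x y) : Stb f (w x) (w y) :=
  fun _ hv => h _ (hv.comp hw)

theorem Stb.trans' {f : ℕ → ℕ} {x y z : ℕ} (h : Stb f x y) (h' : Stb f y z) : Stb f x z := by
  intro w hw
  obtain ⟨v, hv, e⟩ := h w hw
  have := h' _ (hv.comp hw)
  refine Syn.of hv ?_
  rw [e]
  exact this

theorem Stb.addl {f : ℕ → ℕ} {x y : ℕ} (h : Stb f x y) (a : ℕ) : Stb f (a + x) (a + y) :=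
  Stb.map (WW.tr a _ WW.one) h

theorem Stb.ap {f : ℕ → ℕ} {x y : ℕ} (h : Stb f x y) : Stb f (f x) (f y) :=
  Stb.map (WW.app _ WW.one) h

/-- realising words as a single shift followed by iteration -/
theorem WW.real {f w : ℕ → ℕ}
    (big : ∀ B H c, 1 ≤ c → ∃ N, H ≤ N ∧ ∀ x < B, f (N + x) = c + f x)
    (hw : WW f w) : ∀ B H, ∃ C, ∀ c, C ≤ c → ∃ n s, H ≤ n ∧ ∀ x < B, f^[s] (n + x) = c + w x := by
  induction hw with
  | one => exact fun B H => ⟨H, fun c hc => ⟨c, 0, hc, fun x _ => rfl⟩⟩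
  | tr h w _ ih =>
    intro B H
    obtain ⟨C, hC⟩ := ih B H
    refine ⟨C, fun c hc => ?_⟩
    obtain ⟨n, s, hn, e⟩ := hC (c + h) (by omega)
    exact ⟨n, s, hn, fun x hx => by rw [e x hx]; exact add_assoc _ _ _⟩
  | app w _ ih =>
    intro B H
    obtain ⟨C, hC⟩ := ih B H
    refine ⟨1, fun c hc => ?_⟩
    obtain ⟨N, hN, e⟩ := big ((Finset.range B).sup w + 1) C c hc
    obtain ⟨n, s, hn, e'⟩ := hC N hN
    refine ⟨n, s + 1, hn, fun x hx => ?_⟩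
    rw [Function.iterate_succ_apply', e' x hx, e]
    exact Nat.lt_succ_of_le (Finset.le_sup (f := w) (Finset.mem_range.2 hx))

theorem Stb.cancel {f : ℕ → ℕ}
    (big : ∀ B H c, 1 ≤ c → ∃ N, H ≤ N ∧ ∀ x < B, f (N + x) = c + f x)
    {h x y : ℕ} (hs : Stb f (h + x) (h + y)) : Stb f x y := by
  intro w hw
  obtain ⟨C, hC⟩ := hw.real big (x + y + 1) h
  obtain ⟨n, s, hn, e⟩ := hC C le_rfl
  have h1 := (hs.addl (n - h)) _ (WW.iter f s)
  rw [show n - h + (h + x) = n + x by omega, show n - h + (h + y) = n + y by omega,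
    e x (by omega), e y (by omega)] at h1
  exact Syn.of (WW.tr C _ WW.one) h1

theorem exists_stb {f : ℕ → ℕ} (b : ℕ) (hb : 2 ≤ b)
    (hA : ∀ K m y, y < b ^ K → f (b ^ K * m + y) = f m + f y)
    (h0 : f 0 = 0) (h1 : f 1 = 1) (B : ℕ)
    (hrep : ∀ c, ∃ m, f m = c)
    (hB : ∀ X : Finset ℕ, ∃ s, ∀ x ∈ X, f^[s] x < B) :
    ∃ P Q, P < Q ∧ Stb f P Q := by
  classical
  let CL : Finset ℕ → Prop := fun X => ∀ x ∈ X, ∀ y ∈ X, x ≠ y → ¬ Syn f x y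
  have hbd : ∀ X, CL X → X.card ≤ B := by
    intro X hX
    obtain ⟨s, hs⟩ := hB X
    have : X.card ≤ (Finset.range B).card := by
      apply Finset.card_le_card_of_injOn (fun x => f^[s] x)
      · intro x hx
        simpa using hs x hx
      · intro x hx y hy e
        by_contra hne
        exact hX x hx y hy hne ⟨_, WW.iter f s, e⟩
    simpa using this
  obtain ⟨X, hX, hmax⟩ : ∃ X, CL X ∧ ∀ Y, CL Y → Y.card ≤ X.card := by
    have hm := Nat.sSup_mem (s := {k | ∃ X, CL X ∧ X.card = k})
      ⟨0, ∅, by simp [CL], rfl⟩ ⟨B, by rintro k ⟨X, hX, rfl⟩; exact hbd X hX⟩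
    obtain ⟨X, hX, e⟩ := hm
    refine ⟨X, hX, fun Y hY => ?_⟩
    rw [e]
    exact le_csSup ⟨B, by rintro k ⟨X, hX, rfl⟩; exact hbd X hX⟩ ⟨Y, hY, rfl⟩
  have hne : X.Nonempty := by
    rw [← Finset.card_pos]
    have := hmax {0} (by simp [CL])
    simp at this
    exact Finset.card_pos.2 this
  obtain ⟨t, ht, htm⟩ : ∃ t ∈ X, ∀ x ∈ X, x ≤ t :=
    ⟨X.max' hne, X.max'_mem hne, fun x hx => X.le_max' x hx⟩
  -- the two prefixes
  obtain ⟨p2, hp2⟩ : ∃ n, f (n + 1) ≠ f n + 1 := by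
    by_contra hcon
    push Not at hcon
    have hid : ∀ n, f n = n := by
      intro n
      induction n with
      | zero => exact h0
      | succ n ih => rw [hcon, ih]
    have := hA 1 1 0 (by positivity)
    rw [h0, h1, hid] at this
    simp at this
    omega
  obtain ⟨m, hm⟩ := hrep (f p2)
  have hq1 : f (b ^ 1 * m + 0) = f p2 := by
    rw [hA 1 m 0 (by positivity), h0, hm]; rfl
  have hq2 : f (b ^ 1 * m + 0 + 1) = f p2 + 1 := by
    have := hA 1 m 1 (by rw [pow_one]; omega)
    rw [h1, hm] at this
    simpa using this
  set p1 := b ^ 1 * m + 0 with hp1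
  have htb : t < b ^ t := Nat.lt_pow_self (by omega)
  let w : ℕ → ℕ → ℕ := fun p x => f ((b ^ t * p + (b ^ t - t)) + x)
  have hw : ∀ p, WW f (w p) := fun p => WW.app _ (WW.tr _ _ WW.one)
  have hwlt : ∀ p x, x < t → w p x = f p + f (b ^ t - t + x) := by
    intro p x hx
    show f _ = _
    rw [add_assoc, hA _ _ _ (by omega)]
  have hwt : ∀ p, w p t = f (p + 1) := by
    intro p
    show f _ = _
    have := hA t (p + 1) 0 (by omega)
    rw [h0] at this
    rw [← show b ^ t * (p + 1) + 0 = b ^ t * p + (b ^ t - t) + t by rw [mul_add]; omega, this]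
    rfl
  have hwe : ∀ x, x < t → w p1 x = w p2 x := by
    intro x hx
    rw [hwlt _ _ hx, hwlt _ _ hx, hq1]
  have hst : Stb f (w p1 t) (w p2 t) := by
    intro v hv
    by_contra hns
    have hu1 : WW f (fun x => v (w p1 x)) := hv.comp (hw p1)
    have hu2 : WW f (fun x => v (w p2 x)) := hv.comp (hw p2)
    have hinj : Set.InjOn (fun x => v (w p1 x)) X := by
      intro x hx y hy e
      by_contra hne
      exact hX x hx y hy hne ⟨_, hu1, e⟩
    have hnew : ∀ x ∈ X, ¬ Syn f (v (w p1 x)) (v (w p2 t)) := by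
      intro x hx hsyn
      rcases (htm x hx).lt_or_eq with hlt | rfl
      · rw [hwe x hlt] at hsyn
        exact hX x hx t ht (by omega) (Syn.of hu2 hsyn)
      · exact hns hsyn
    have hcl : CL (insert (v (w p2 t)) (X.image (fun x => v (w p1 x)))) := by
      intro x hx y hy hxy hs
      rw [Finset.mem_insert, Finset.mem_image] at hx hy
      rcases hx with rfl | ⟨x, hx, rfl⟩ <;> rcases hy with rfl | ⟨y, hy, rfl⟩
      · exact hxy rfl
      · exact hnew y hy hs.symm'
      · exact hnew x hx hs
      · refine hX x hx y hy ?_ (Syn.of hu1 hs)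
        rintro rfl
        exact hxy rfl
    have hc := hmax _ hcl
    rw [Finset.card_insert_of_notMem, Finset.card_image_of_injOn hinj] at hc
    · omega
    · intro hmem
      rw [Finset.mem_image] at hmem
      obtain ⟨x, hx, e⟩ := hmem
      apply hnew x hx
      rw [e]
      exact Syn.rfl' _
  rw [hwt, hwt, hq2] at hst
  rcases lt_or_gt_of_ne hp2 with h | h
  · exact ⟨_, _, h, hst.symm'⟩
  · exact ⟨_, _, h, hst⟩

theorem stb_self {f : ℕ → ℕ} (b : ℕ) (hb : 2 ≤ b)
    (hA : ∀ K m y, y < b ^ K → f (b ^ K * m + y) = f m + f y)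
    (h0 : f 0 = 0) (h1 : f 1 = 1)
    (big : ∀ B H c, 1 ≤ c → ∃ N, H ≤ N ∧ ∀ x < B, f (N + x) = c + f x)
    (P Q : ℕ) (hPQ : P < Q) (hs : Stb f P Q) : ∀ n, Stb f (f n) n := by
  obtain ⟨M, rfl⟩ : ∃ M, Q = P + M := ⟨Q - P, by omega⟩
  have hM : 0 < M := by omega
  have h0M : Stb f 0 M := Stb.cancel big (h := P) (by simpa using hs)
  have hper : ∀ x k, Stb f x (x + M * k) := by
    intro x k
    induction k with
    | zero => simpa using Stb.rfl' x
    | succ k ih =>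
      refine ih.trans' ?_
      have := h0M.addl (x + M * k)
      simpa [mul_add, add_assoc] using this
  have hmod : ∀ x, Stb f (x % M) x := by
    intro x
    have := hper (x % M) (x / M)
    rwa [Nat.mod_add_div] at this
  have hMb : M < b ^ M := Nat.lt_pow_self (by omega)
  have hone : ∀ x, Stb f (f (x + b ^ M)) (f x + 1) := by
    intro x
    have e1 : Stb f (x + b ^ M) (b ^ M * 1 + x % M) := by
      have := ((hmod x).symm').addl (b ^ M)
      simpa [add_comm] using this
    have e2 := e1.ap
    rw [hA _ _ _ ((Nat.mod_lt _ hM).trans hMb), h1] at e2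
    refine e2.trans' ?_
    have := ((hmod x).ap).addl 1
    rwa [add_comm (f x)]
  have hj : ∀ j, Stb f (f (b ^ M * j)) j := by
    intro j
    induction j with
    | zero => simpa [h0] using Stb.rfl' (f := f) 0
    | succ j ih =>
      have := (hone (b ^ M * j)).trans' (by
        have := ih.addl 1
        rwa [add_comm 1, add_comm 1] at this)
      simpa [mul_add] using this
  have hb1 : Stb f 1 b := by
    have := hj b
    rw [← pow_succ] at this
    have e := hA (M + 1) 1 0 (by positivity)
    rw [h0, h1] at e
    simp only [mul_one, add_zero] at e
    rwa [e] at this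
  have h0b : Stb f 0 (b - 1) := by
    apply Stb.cancel big (h := 1)
    rwa [show 1 + (b - 1) = b by omega]
  have hbk : ∀ k, Stb f 0 ((b - 1) * k) := by
    intro k
    induction k with
    | zero => simpa using Stb.rfl' (f := f) 0
    | succ k ih =>
      refine ih.trans' ?_
      have := h0b.addl ((b - 1) * k)
      simpa [mul_add] using this
  have hpow : Stb f 1 (b ^ M) := by
    obtain ⟨k, hk⟩ : (b - 1) ∣ b ^ M - 1 := by
      simpa using Nat.sub_dvd_pow_sub_pow b 1 M
    have := (hbk k).addl 1
    rw [← hk] at this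
    rwa [show 1 + (b ^ M - 1) = b ^ M by omega] at this
  intro n
  induction n with
  | zero => rw [h0]; exact Stb.rfl' _
  | succ n ih =>
    refine ((hpow.addl n).ap).trans' ((hone n).trans' ?_)
    have := ih.addl 1
    rwa [add_comm 1, add_comm 1] at this

theorem sync_all {f : ℕ → ℕ} (n : ℕ) : ∀ X : Finset ℕ, X.card ≤ n →
    (∀ x ∈ X, ∀ y ∈ X, Stb f x y) → ∃ w z, WW f w ∧ ∀ x ∈ X, w x = z := by
  classical
  induction n with
  | zero =>
    intro X hX _
    have : X = ∅ := by simpa using hX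
    subst this
    exact ⟨_, 0, WW.one, by simp⟩
  | succ n ih =>
    intro X hX hs
    by_cases hc : ∃ x ∈ X, ∃ y ∈ X, x ≠ y
    · obtain ⟨x, hx, y, hy, hxy⟩ := hc
      obtain ⟨w, hw, e⟩ := hs x hx y hy _ WW.one
      have hcard : (X.image w).card ≤ n := by
        have hsub : X.image w ⊆ (X.erase y).image w := by
          intro z hz
          rw [Finset.mem_image] at hz ⊢
          obtain ⟨a, ha, rfl⟩ := hz
          by_cases hay : a = y
          · subst hay
            exact ⟨x, Finset.mem_erase.2 ⟨hxy, hx⟩, e⟩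
          · exact ⟨a, Finset.mem_erase.2 ⟨hay, ha⟩, rfl⟩
        have h1 := Finset.card_le_card hsub
        have h2 : ((X.erase y).image w).card ≤ (X.erase y).card := Finset.card_image_le
        rw [Finset.card_erase_of_mem hy] at h2
        omega
      obtain ⟨v, z, hv, hz⟩ := ih (X.image w) hcard (by
        intro a ha c hc
        rw [Finset.mem_image] at ha hc
        obtain ⟨a, ha, rfl⟩ := ha
        obtain ⟨c, hc, rfl⟩ := hc
        exact (hs a ha c hc).map hw)
      exact ⟨_, z, hv.comp hw, fun a ha => hz _ (Finset.mem_image_of_mem w ha)⟩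
    · push Not at hc
      rcases X.eq_empty_or_nonempty with rfl | ⟨a, ha⟩
      · exact ⟨_, 0, WW.one, by simp⟩
      · exact ⟨_, a, WW.one, fun x hx => hc x hx a ha⟩

theorem contract {f : ℕ → ℕ} (b C : ℕ) (hb : 2 ≤ b) (hC : ∀ n, f n ≤ C + f (n / b)) :
    ∃ B, (∀ n, n < B → f n < B) ∧ ∀ n, B ≤ n → f n < n := by
  obtain ⟨E, hE⟩ : ∃ E, ∀ n < 4 * C + 1, 2 * f n ≤ E :=
    ⟨(Finset.range (4 * C + 1)).sup (fun n => 2 * f n), fun n hn =>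
      Finset.le_sup (f := fun n => 2 * f n) (Finset.mem_range.2 hn)⟩
  have key : ∀ n, 2 * f n ≤ n + E := by
    intro n
    induction n using Nat.strong_induction_on with
    | _ n ih =>
      by_cases hn : n < 4 * C + 1
      · have := hE n hn
        omega
      · have h2 : n / b ≤ n / 2 := Nat.div_le_div_left hb (by norm_num)
        have h3 := ih (n / b) (by omega)
        have := hC n
        omega
  refine ⟨E + 1, fun n hn => ?_, fun n hn => ?_⟩
  · have := key n; omega
  · have := key n; omega

/-- If for each `x ∈ D` some `h_x` makes `h_x + u` and `h_x + x`
concurrently `u`-integers, then some `h` makes `h + x` a `u`-integer for all `x ∈ D`. -/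
theorem stmt_5 (b : ℕ) (hb : 2 ≤ b) (fstar : ℕ → ℕ) (f : ℕ → ℕ)
    (hf : ∀ n, f n = ((Nat.digits b n).map fstar).sum)
    (h0 : fstar 0 = 0) (h1 : fstar 1 = 1)
    (u : ℕ) (hu : 0 < u) (hcyc : ∃ r : ℕ, 1 ≤ r ∧ f^[r] u = u)
    (hyp : ∀ x : ℕ, (0 < x ∧ ∃ r : ℕ, 1 ≤ r ∧ f^[r] x = x) →
      ∃ h : ℕ, 0 < h ∧ ∃ r : ℕ, 1 ≤ r ∧ f^[r] (h + u) = u ∧ f^[r] (h + x) = u) :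
    ∃ h : ℕ, 0 < h ∧ ∀ x : ℕ, (0 < x ∧ ∃ r : ℕ, 1 ≤ r ∧ f^[r] x = x) →
      ∃ r : ℕ, 1 ≤ r ∧ f^[r] (h + x) = u := by
  classical
  have f0 : f 0 = 0 := by simp [hf]
  have hstep : ∀ n, f n = fstar (n % b) + f (n / b) := by
    intro n
    rcases Nat.eq_zero_or_pos n with rfl | hn
    · simp [f0, h0]
    · rw [hf n, Nat.digits_def' (by omega) hn, hf (n / b)]
      simp
  have f1 : f 1 = 1 := by
    rw [hstep, Nat.mod_eq_of_lt (by omega), Nat.div_eq_of_lt (by omega), h1, f0]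
  have hA : ∀ K m y, y < b ^ K → f (b ^ K * m + y) = f m + f y := by
    intro K
    induction K with
    | zero =>
      intro m y hy
      have : y = 0 := by simpa using hy
      subst this
      simp [f0]
    | succ K ih =>
      intro m y hy
      have e : b ^ (K + 1) * m + y = y + b * (b ^ K * m) := by ring
      rw [hstep, e, Nat.add_mul_mod_self_left, Nat.add_mul_div_left _ _ (by omega), add_comm (y / b),
        ih _ _ (by rw [Nat.div_lt_iff_lt_mul (by omega), ← pow_succ]; exact hy), hstep y]
      omega
  have hrep : ∀ c, ∃ m, f m = c := by
    intro c
    induction c with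
    | zero => exact ⟨0, f0⟩
    | succ c ih =>
      obtain ⟨m, hm⟩ := ih
      exact ⟨b ^ 1 * m + 1, by rw [hA 1 m 1 (by rw [pow_one]; omega), hm, f1]⟩
  have big : ∀ B H c, 1 ≤ c → ∃ N, H ≤ N ∧ ∀ x < B, f (N + x) = c + f x := by
    intro B H c hc
    obtain ⟨m, hm⟩ := hrep c
    have hm0 : 1 ≤ m := by
      rcases Nat.eq_zero_or_pos m with rfl | h
      · omega
      · exact h
    have hlt : B + H < b ^ (B + H) := Nat.lt_pow_self (by omega)
    refine ⟨b ^ (B + H) * m, ?_, fun x hx => ?_⟩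
    · have := Nat.le_mul_of_pos_right (b ^ (B + H)) hm0
      omega
    · rw [hA _ _ _ (by omega), hm]
  obtain ⟨B, hB1, hB2⟩ := contract (f := f) b ((Finset.range b).sup fstar) hb (by
    intro n
    rw [hstep n]
    have : fstar (n % b) ≤ (Finset.range b).sup fstar :=
      Finset.le_sup (Finset.mem_range.2 (Nat.mod_lt _ (by omega)))
    omega)
  have hBX : ∀ X : Finset ℕ, ∃ s, ∀ x ∈ X, f^[s] x < B := by
    intro X
    refine ⟨X.sup id + 1, fun x hx => ?_⟩
    have hk : ∀ s, f^[s] x < B ∨ f^[s] x + s ≤ x := by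
      intro s
      induction s with
      | zero => right; simp
      | succ s ih =>
        rw [Function.iterate_succ_apply']
        by_cases h : f^[s] x < B
        · left; exact hB1 _ h
        · have := hB2 _ (not_lt.1 h)
          omega
    have hle : x ≤ X.sup id := Finset.le_sup (f := id) hx
    rcases hk (X.sup id + 1) with h | h
    · exact h
    · omega
  have hDB : ∀ x r, 1 ≤ r → f^[r] x = x → x < B := by
    intro x r hr e
    by_contra hx
    have hk : ∀ s, f^[s + 1] x < x := by
      intro s
      induction s with
      | zero => exact hB2 x (by omega)
      | succ s ih =>
        rw [Function.iterate_succ_apply']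
        by_cases h : f^[s + 1] x < B
        · have := hB1 _ h
          omega
        · have := hB2 _ (not_lt.1 h)
          omega
    have := hk (r - 1)
    rw [show r - 1 + 1 = r by omega] at this
    omega
  obtain ⟨P, Q, hPQ, hst⟩ := exists_stb b hb hA f0 f1 B hrep hBX
  have hself := stb_self b hb hA f0 f1 big P Q hPQ hst
  have hit : ∀ s n, Stb f (f^[s] n) n := by
    intro s n
    induction s with
    | zero => exact Stb.rfl' _
    | succ s ih =>
      rw [Function.iterate_succ_apply']
      exact (hself _).trans' ih
  have hux : ∀ x, (0 < x ∧ ∃ r : ℕ, 1 ≤ r ∧ f^[r] x = x) → Stb f u x := by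
    intro x hx
    obtain ⟨h, _, r, _, e1, e2⟩ := hyp x hx
    apply Stb.cancel big (h := h)
    have a1 := hit r (h + u)
    have a2 := hit r (h + x)
    rw [e1] at a1
    rw [e2] at a2
    exact a1.symm'.trans' a2
  obtain ⟨w, z, hw, hz⟩ := sync_all _
    ((Finset.range B).filter (fun x => 0 < x ∧ ∃ r : ℕ, 1 ≤ r ∧ f^[r] x = x)) le_rfl (by
      intro x hx y hy
      rw [Finset.mem_filter] at hx hy
      exact (hux x hx.2).symm'.trans' (hux y hy.2))
  obtain ⟨C, hC⟩ := hw.real big B 1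
  obtain ⟨N, hN, e⟩ := big 1 (C + z) u hu
  have eN := e 0 (by omega)
  rw [f0] at eN
  obtain ⟨n, s, hn, hns⟩ := hC (N - z) (by omega)
  refine ⟨n, hn, fun x hx => ⟨s + 1, by omega, ?_⟩⟩
  obtain ⟨hx0, r, hr, er⟩ := hx
  have hxB := hDB x r hr er
  have := hz x (Finset.mem_filter.2 ⟨Finset.mem_range.2 hxB, hx0, r, hr, er⟩)
  rw [Function.iterate_succ_apply', hns x hxB, this, show N - z + z = N + 0 by omega, eN]
  rfl
end

section
/- Let u be a cycle number. Assume that for each x ∈ D there exists a positive integer h_x such that h_x + u and h_x + x are concurrently u-integers. Then for every nonempty finite subset X of D with u ∈ X, there exists a positive integer h_X such that h_X + x is a u-integer for every x ∈ X. -/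
/-- one difference step -/
def DStep (f : ℕ → ℕ) (x y : ℤ) : Prop :=
  ∃ e e' : ℕ, (e' : ℤ) - e = x ∧ (f e' : ℤ) - f e = y

/-- mergeable difference -/
def DMerg (f : ℕ → ℕ) (x : ℤ) : Prop := Relation.ReflTransGen (DStep f) x 0

theorem DStep.neg {f : ℕ → ℕ} {x y : ℤ} (h : DStep f x y) : DStep f (-x) (-y) := by
  obtain ⟨e, e', h1, h2⟩ := h
  exact ⟨e', e, by omega, by omega⟩

theorem DMerg.neg {f : ℕ → ℕ} {x : ℤ} (h : DMerg f x) : DMerg f (-x) := by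
  unfold DMerg at *
  induction h using Relation.ReflTransGen.head_induction_on with
  | refl => simpa using Relation.ReflTransGen.refl
  | head h1 _ ih => exact Relation.ReflTransGen.head h1.neg ih

theorem fib_card {Z : Type*} [AddCommGroup Z] [Fintype Z] [DecidableEq Z]
    (Good : (Z → Z) → Prop) (hcomp : ∀ p q, Good p → Good q → Good (fun z => p (q z)))
    (htr : ∀ t, Good (fun z => z + t)) (ψ : Z → Z) (hψ : Good ψ)
    (hmin : ∀ p, Good p → (Finset.univ.image ψ).card ≤ (Finset.univ.image p).card)
    (y : Z) (hy : y ∈ Finset.univ.image ψ) :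
    (Finset.univ.image ψ).card * (Finset.univ.filter (fun t => ψ t = y)).card
      = Fintype.card Z := by
  classical
  set I := Finset.univ.image ψ with hI
  have h1 : ∀ t : Z, (I.filter (fun i => ψ (i + t) = y)).card = 1 := by
    intro t
    have hg : Good (fun z => ψ (ψ z + t)) :=
      hcomp ψ (fun z => ψ z + t) hψ (hcomp _ ψ (htr t) hψ)
    have him : Finset.univ.image (fun z => ψ (ψ z + t)) = I.image (fun i => ψ (i + t)) := by
      rw [hI, Finset.image_image]; rfl
    have hc := hmin _ hg
    rw [him] at hc
    have hsub : I.image (fun i => ψ (i + t)) ⊆ I := by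
      intro z hz
      obtain ⟨i, _, rfl⟩ := Finset.mem_image.1 hz
      exact Finset.mem_image_of_mem _ (Finset.mem_univ _)
    have heq := Finset.eq_of_subset_of_card_le hsub hc
    have hinj : Set.InjOn (fun i => ψ (i + t)) (I : Set Z) :=
      Finset.card_image_iff.1 (le_antisymm Finset.card_image_le hc)
    rw [← heq] at hy
    obtain ⟨i, hi, hiy⟩ := Finset.mem_image.1 hy
    rw [Finset.card_eq_one]
    refine ⟨i, ?_⟩
    ext k
    simp only [Finset.mem_filter, Finset.mem_singleton]
    constructor
    · rintro ⟨hk, hk2⟩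
      exact hinj hk hi (hk2.trans hiy.symm)
    · rintro rfl
      exact ⟨hi, hiy⟩
  have h2 : ∑ t : Z, (I.filter (fun i => ψ (i + t) = y)).card = Fintype.card Z := by
    simp [h1]
  have h3 : ∑ t : Z, (I.filter (fun i => ψ (i + t) = y)).card
      = ∑ i ∈ I, (Finset.univ.filter (fun t => ψ (i + t) = y)).card := by
    simp only [Finset.card_filter]
    exact Finset.sum_comm
  have h4 : ∀ i ∈ I, (Finset.univ.filter (fun t => ψ (i + t) = y)).card
      = (Finset.univ.filter (fun t => ψ t = y)).card := by
    intro i _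
    apply Finset.card_bij (fun t _ => i + t)
    · intro t ht; simpa using ht
    · intro t _ t' _ h; simpa using h
    · intro t ht; exact ⟨t - i, by simpa using ht, by simp⟩
  rw [← h2, h3, Finset.sum_congr rfl h4, Finset.sum_const, smul_eq_mul]

section
variable {b : ℕ} {f fstar : ℕ → ℕ}

theorem f_pow (hb : 2 ≤ b) (hrec : ∀ n d, d < b → f (b * n + d) = f n + fstar d) (f0 : f 0 = 0) :
    ∀ k m n, n < b ^ k → f (b ^ k * m + n) = f m + f n := by
  intro k
  induction k with
  | zero => intro m n h; have : n = 0 := by simpa using h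
            subst this; simp [f0]
  | succ k ih =>
    intro m n h
    have hb0 : 0 < b := by omega
    have hd := Nat.mod_lt n hb0
    have hn : n / b < b ^ k := by
      rw [Nat.div_lt_iff_lt_mul hb0]; rwa [pow_succ] at h
    have e1 : b ^ (k+1) * m + n = b * (b ^ k * m + n / b) + n % b := by
      conv_lhs => rw [← Nat.div_add_mod n b]
      ring
    have e2 : f n = f (n / b) + fstar (n % b) := by
      conv_lhs => rw [← Nat.div_add_mod n b]
      exact hrec _ _ hd
    rw [e1, hrec _ _ hd, ih _ _ hn, e2]; ring

theorem f_digit (hrec : ∀ n d, d < b → f (b * n + d) = f n + fstar d) (f0 : f 0 = 0)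
    (d : ℕ) (hd : d < b) : f d = fstar d := by
  have := hrec 0 d hd
  simpa [f0] using this

theorem m1_nat (hb : 2 ≤ b) (hrec : ∀ n d, d < b → f (b * n + d) = f n + fstar d) (f0 : f 0 = 0)
    (x c d : ℕ) (hc : c + 2 ≤ b) (hd : d + 2 ≤ b)
    (hdiv : ((b:ℤ) - 1) ∣ (c:ℤ) + x - d) :
    DStep f x ((fstar d : ℤ) - fstar c) := by
  have hx : x < b ^ x := Nat.lt_pow_self (by omega)
  have hbp : ((b:ℤ) - 1) ∣ (b:ℤ)^x - 1 := sub_one_dvd_pow_sub_one _ _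
  have hD : ((b:ℤ) - 1) ∣ (x:ℤ) + c * (b:ℤ)^x - d := by
    have : (x:ℤ) + c * (b:ℤ)^x - d = (c + x - d) + c * ((b:ℤ)^x - 1) := by ring
    rw [this]; exact dvd_add hdiv (Dvd.dvd.mul_left hbp _)
  obtain ⟨r, hr⟩ := hD
  have hx' : (x:ℤ) < (b:ℤ)^x := by exact_mod_cast hx
  have hcb : (c:ℤ) + 2 ≤ b := by exact_mod_cast hc
  have hdb : (d:ℤ) + 2 ≤ b := by exact_mod_cast hd
  have hr0 : 0 ≤ r := by
    have : (0:ℤ) ≤ (c:ℤ) * (b:ℤ)^x := by positivity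
    by_contra hneg
    have : r ≤ -1 := by omega
    nlinarith
  have hr1 : r < (b:ℤ)^x := by
    by_contra hneg
    push Not at hneg
    nlinarith
  lift r to ℕ using hr0
  have hr1' : r < b ^ x := by exact_mod_cast hr1
  refine ⟨b ^ x * c + r, b * r + d, ?_, ?_⟩
  · push_cast; linarith
  · rw [f_pow hb hrec f0 _ _ _ hr1', hrec _ _ (by omega), f_digit hrec f0 c (by omega)]
    push_cast; ring

theorem m1 (hb : 2 ≤ b) (hrec : ∀ n d, d < b → f (b * n + d) = f n + fstar d) (f0 : f 0 = 0)
    (x : ℤ) (c d : ℕ) (hc : c + 2 ≤ b) (hd : d + 2 ≤ b)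
    (hdiv : ((b:ℤ) - 1) ∣ (c:ℤ) + x - d) :
    DStep f x ((fstar d : ℤ) - fstar c) := by
  obtain ⟨n, rfl | rfl⟩ := x.eq_nat_or_neg
  · exact m1_nat hb hrec f0 n c d hc hd hdiv
  · have := (m1_nat hb hrec f0 n d c hd hc (by
      have h := (dvd_neg (a := (b:ℤ) - 1)).2 hdiv
      rw [show (d:ℤ) + n - c = -((c:ℤ) + -(n:ℤ) - d) by ring]
      exact h)).neg
    rwa [neg_sub] at this

theorem m2 (hb : 2 ≤ b) (hrec : ∀ n d, d < b → f (b * n + d) = f n + fstar d) (f0 : f 0 = 0)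
    (h0 : fstar 0 = 0)
    (x a ρ : ℕ) (hx : 0 < x) (ha : a + 2 ≤ b) (hρ : ρ + 2 ≤ b)
    (hdiv : ((b:ℤ) - 1) ∣ 1 - (x:ℤ) - ρ) :
    DStep f x ((fstar (a+1) : ℤ) - fstar a - fstar ρ) := by
  set l := Nat.log b x with hl
  have hl1 : b ^ l ≤ x := Nat.pow_log_le_self b (by omega)
  have hl2 : x < b ^ (l+1) := Nat.lt_pow_succ_log_self (by omega) x
  by_cases hcase : x = b ^ l ∧ ρ = 0
  · obtain ⟨hxl, rfl⟩ := hcase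
    have hp : 0 < b ^ l := by positivity
    have e1 := f_pow hb hrec f0 l a 0 hp
    have e2 := f_pow hb hrec f0 l (a+1) 0 hp
    refine ⟨b^l * a + 0, b^l * (a+1) + 0, ?_, ?_⟩
    · rw [hxl]; push_cast; ring
    · rw [e1, e2, f_digit hrec f0 a (by omega), f_digit hrec f0 (a+1) (by omega), h0, f0]
      push_cast; ring
  have hD : ((b:ℤ) - 1) ∣ (b:ℤ)^(l+1) - x - ρ := by
    have : (b:ℤ)^(l+1) - x - ρ = (1 - x - ρ) + ((b:ℤ)^(l+1) - 1) := by ring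
    rw [this]; exact dvd_add hdiv (sub_one_dvd_pow_sub_one _ _)
  obtain ⟨m, hm⟩ := hD
  have hl1' : (b:ℤ)^l ≤ x := by exact_mod_cast hl1
  have hl2' : (x:ℤ) < (b:ℤ)^(l+1) := by exact_mod_cast hl2
  have hdb : (ρ:ℤ) + 2 ≤ b := by exact_mod_cast hρ
  have hm0 : 0 ≤ m := by
    by_contra hneg
    have : m ≤ -1 := by omega
    nlinarith
  have hm1 : m < (b:ℤ)^l := by
    by_contra hneg
    push Not at hneg
    have h1 : ((b:ℤ) - 1) * (b:ℤ)^l ≤ ((b:ℤ) - 1) * m :=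
      mul_le_mul_of_nonneg_left hneg (by omega)
    have h2 : ((b:ℤ) - 1) * (b:ℤ)^l = (b:ℤ)^(l+1) - (b:ℤ)^l := by ring
    apply hcase
    constructor
    · have : (x:ℤ) = (b:ℤ)^l := by linarith [Int.natCast_nonneg ρ]
      exact_mod_cast this
    · have : (ρ:ℤ) ≤ 0 := by linarith
      omega
  lift m to ℕ using hm0
  have hm1' : m < b ^ l := by exact_mod_cast hm1
  have hm2 : m < b ^ (l+1) := lt_of_lt_of_le hm1' (Nat.pow_le_pow_right (by omega) (by omega))
  have hm3 : b * m + ρ < b ^ (l+1) := by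
    have : b * (m+1) ≤ b * b ^ l := Nat.mul_le_mul_left _ hm1'
    rw [pow_succ']; nlinarith
  refine ⟨b^(l+1) * a + (b * m + ρ), b^(l+1) * (a+1) + m, ?_, ?_⟩
  · push_cast; linarith
  · rw [f_pow hb hrec f0 _ _ _ hm3, f_pow hb hrec f0 _ _ _ hm2, hrec _ _ (by omega),
      f_digit hrec f0 a (by omega), f_digit hrec f0 (a+1) (by omega)]
    push_cast; ring

/-- every integer in the class is mergeable -/
def EMerg (f : ℕ → ℕ) (N : ℕ) (r : ZMod N) : Prop := ∀ x : ℤ, (x : ZMod N) = r → DMerg f x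

theorem EMerg.neg {N : ℕ} {r : ZMod N} (h : EMerg f N r) : EMerg f N (-r) := by
  intro x hx
  have := (h (-x) (by push_cast; rw [hx]; simp)).neg
  simpa using this

theorem core (hb : 2 ≤ b) (hrec : ∀ n d, d < b → f (b * n + d) = f n + fstar d) (f0 : f 0 = 0)
    (h0 : fstar 0 = 0) (h1 : fstar 1 = 1) :
    ∃ G : AddSubgroup ℤ, (∀ n : ℕ, (f n : ℤ) - n ∈ G) ∧ ∀ x ∈ G, DMerg f x := by
  classical
  obtain ⟨N, rfl⟩ : ∃ N, b = N + 1 := ⟨b - 1, by omega⟩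
  have hN : 0 < N := by omega
  have : NeZero N := ⟨by omega⟩
  set φ : ZMod N → ZMod N := fun z => (fstar z.val : ZMod N) with hφ
  have hval : ∀ z : ZMod N, z.val + 2 ≤ N + 1 := fun z => by have := ZMod.val_lt z; omega
  have hcast : ∀ z : ZMod N, ((z.val : ℕ) : ZMod N) = z := fun z => ZMod.natCast_zmod_val z
  have hdv : ∀ y : ℤ, (y : ZMod N) = 0 → (((N+1 : ℕ):ℤ) - 1) ∣ y := by
    intro y hy
    have := (ZMod.intCast_zmod_eq_zero_iff_dvd y N).1 hy
    simpa using this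
  have M1 : ∀ (x : ℤ) (s t : ZMod N), (x : ZMod N) = t - s →
      DStep f x ((fstar t.val : ℤ) - fstar s.val) := by
    intro x s t hx
    apply m1 hb hrec f0 x _ _ (hval s) (hval t)
    apply hdv
    push_cast
    rw [hcast, hcast, hx]; ring
  have M2 : ∀ (x : ℤ) (a : ℕ), 0 < x → a < N →
      DStep f x ((fstar (a+1) : ℤ) - fstar a - fstar (1 - (x : ZMod N)).val) := by
    intro x a hx ha
    lift x to ℕ using hx.le
    apply m2 hb hrec f0 h0 x a _ (by exact_mod_cast hx) (by omega) (hval _)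
    apply hdv
    push_cast
    rw [hcast]; ring
  have E0 : EMerg f N 0 := by
    intro x hx
    have := M1 x 0 0 (by simpa using hx)
    rw [sub_self] at this
    exact Relation.ReflTransGen.single this
  have φ1 : φ 1 = 1 := by
    rcases Nat.lt_or_ge 1 N with h | h
    · have : Fact (1 < N) := ⟨h⟩
      simp [hφ, ZMod.val_one, h1]
    · have : N = 1 := by omega
      subst this
      exact Subsingleton.elim _ _
  let Good : (ZMod N → ZMod N) → Prop :=
    fun p => ∀ s t, EMerg f N (p t - p s) → EMerg f N (t - s)
  have hcomp : ∀ p q, Good p → Good q → Good (fun z => p (q z)) :=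
    fun p q hp hq s t h => hq _ _ (hp _ _ h)
  have htr : ∀ t, Good (fun z => z + t) := by
    intro t s s' h
    simpa using h
  have hφG : Good φ := by
    intro s t h x hx
    refine Relation.ReflTransGen.head (M1 x s t hx) (h _ ?_)
    simp [hφ]
  obtain ⟨p, -, hp⟩ := Finset.exists_max_image (Finset.univ : Finset (ZMod N))
    (fun z => fstar z.val) ⟨0, Finset.mem_univ _⟩
  let θ : ZMod N → ZMod N := fun z => φ (φ z + (1 - φ p))
  have hθG : Good θ :=
    hcomp φ (fun z => φ z + (1 - φ p)) hφG (hcomp (fun z => z + (1 - φ p)) φ (htr _) hφG)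
  let θa : ℕ → ZMod N → ZMod N := fun a z =>
    if fstar z.val = fstar p.val then (fstar (a+1) : ZMod N) - fstar a else θ z
  have key : ∀ a, a < N → ∀ s t : ZMod N, fstar t.val = fstar p.val →
      fstar s.val ≠ fstar p.val → EMerg f N (θa a t - θa a s) → EMerg f N (t - s) := by
    intro a ha s t ht hs h x hx
    have s1 := M1 x s t hx
    have hlt : fstar s.val < fstar t.val := by
      have := hp s (Finset.mem_univ _)
      omega
    have s2 := M2 _ a (by omega : (0:ℤ) < (fstar t.val : ℤ) - fstar s.val) ha
    refine Relation.ReflTransGen.head s1 (Relation.ReflTransGen.head s2 (h _ ?_))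
    simp only [θa, ht, hs, if_true, if_false, θ, hφ]
    push_cast
    congr 4
    ring_nf
  have hθaG : ∀ a, a < N → Good (θa a) := by
    intro a ha s t h
    by_cases ht : fstar t.val = fstar p.val <;> by_cases hs : fstar s.val = fstar p.val
    · intro x hx
      have := M1 x s t hx
      rw [ht, hs, sub_self] at this
      exact Relation.ReflTransGen.single this
    · exact key a ha s t ht hs h
    · have h' := key a ha t s hs ht (by simpa using h.neg)
      simpa using h'.neg
    · apply hθG
      simpa only [θa, ht, hs, if_false] using h
  -- minimal image
  obtain ⟨ψ, hψ, hmin⟩ : ∃ ψ, Good ψ ∧ ∀ q, Good q →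
      (Finset.univ.image ψ).card ≤ (Finset.univ.image q).card := by
    obtain ⟨ψ, hψ, hm⟩ := WellFounded.has_min
      (measure (fun q : ZMod N → ZMod N => (Finset.univ.image q).card)).wf
      {q | Good q} ⟨φ, hφG⟩
    exact ⟨ψ, hψ, fun q hq => not_lt.1 (hm q hq)⟩
  have himg : ∀ q, Good q → Finset.univ.image (fun z => ψ (q z)) = Finset.univ.image ψ := by
    intro q hq
    apply Finset.eq_of_subset_of_card_le
    · intro z hz
      obtain ⟨i, _, rfl⟩ := Finset.mem_image.1 hz
      exact Finset.mem_image_of_mem _ (Finset.mem_univ _)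
    · exact hmin _ (hcomp _ _ hψ hq)
  have hfib : ∀ q, Good q → ∀ y ∈ Finset.univ.image ψ,
      (Finset.univ.image ψ).card * (Finset.univ.filter (fun t => ψ (q t) = y)).card = N := by
    intro q hq y hy
    have := fib_card Good hcomp htr (fun z => ψ (q z)) (hcomp _ _ hψ hq)
      (by rw [himg q hq]; exact hmin) y (by rw [himg q hq]; exact hy)
    rw [himg q hq] at this
    rw [this, ZMod.card]
  have hv : ∀ a, a < N → ∀ t : ZMod N,
      ψ (t + ((fstar (a+1) : ZMod N) - fstar a - 1)) = ψ t := by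
    intro a ha t
    by_contra hne
    have hy : ψ t ∈ Finset.univ.image ψ := Finset.mem_image_of_mem _ (Finset.mem_univ _)
    have g1 := hfib (fun z => θ z + (t - 1)) (hcomp (fun z => z + (t-1)) θ (htr _) hθG) _ hy
    have g2 := hfib (fun z => θa a z + (t - 1))
      (hcomp (fun z => z + (t-1)) (θa a) (htr _) (hθaG a ha)) _ hy
    have hpos : 0 < (Finset.univ.image ψ).card := Finset.card_pos.2 ⟨_, hy⟩
    have hcard := Nat.eq_of_mul_eq_mul_left hpos (g1.trans g2.symm)
    refine absurd hcard (ne_of_gt (Finset.card_lt_card ?_))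
    rw [Finset.ssubset_iff_of_subset]
    · refine ⟨p, ?_, ?_⟩
      · simp [θ, φ1]
      · simp only [Finset.mem_filter, Finset.mem_univ, true_and, θa, if_true]
        intro h
        apply hne
        rw [← h]; congr 1; ring
    · intro z
      simp only [Finset.mem_filter, Finset.mem_univ, true_and, θa]
      split_ifs with hz
      · intro h
        exfalso; apply hne
        rw [← h]; congr 1; ring
      · exact id
  let G : AddSubgroup ℤ :=
    { carrier := {x | ∀ t : ZMod N, ψ (t + (x : ZMod N)) = ψ t}
      zero_mem' := by intro t; simp
      add_mem' := by
        intro x y hx hy t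
        have h1 := hx t
        have h2 := hy (t + x)
        push_cast
        rw [← add_assoc, h2, h1]
      neg_mem' := by
        intro x hx t
        have := hx (t - x)
        push_cast
        rw [← sub_eq_add_neg, ← this]; simp }
  have hGmem : ∀ x : ℤ, (∀ t : ZMod N, ψ (t + (x : ZMod N)) = ψ t) → x ∈ G := fun x h => h
  have hGN : (N : ℤ) ∈ G := hGmem _ (by intro t; simp)
  have hGd : ∀ d, d ≤ N → (fstar d : ℤ) - d ∈ G := by
    intro d
    induction d with
    | zero => intro _; simp [h0]
    | succ d ih =>
      intro hd
      have := G.add_mem (ih (by omega))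
        (hGmem ((fstar (d+1) : ℤ) - fstar d - 1) (by
          intro t; have := hv d (by omega) t; push_cast; exact this))
      convert this using 1
      push_cast; ring
  refine ⟨G, ?_, ?_⟩
  · intro n
    induction n using Nat.strong_induction_on with
    | _ n ih =>
      rcases Nat.eq_zero_or_pos n with rfl | hn
      · simp [f0]
      · have hlt : n / (N+1) < n := Nat.div_lt_self hn (by omega)
        have hd : n % (N+1) < N+1 := Nat.mod_lt _ (by omega)
        have e := hrec (n / (N+1)) _ hd
        have hdm := Nat.div_add_mod n (N+1)
        rw [hdm] at e
        have := G.sub_mem (G.add_mem (ih _ hlt) (hGd (n % (N+1)) (by omega)))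
          (G.zsmul_mem hGN ((n / (N+1) : ℕ) : ℤ))
        convert this using 1
        rw [e]
        have hdm' : (n:ℤ) = ((N+1 : ℕ) : ℤ) * ((n / (N+1) : ℕ):ℤ) + ((n % (N+1) : ℕ) : ℤ) := by
          exact_mod_cast hdm.symm
        rw [smul_eq_mul]
        conv_lhs => rw [hdm']
        push_cast
        ring
  · intro x hx
    have hx0 : ψ (0 + (x : ZMod N)) = ψ 0 := hx 0
    have := hψ 0 (0 + (x : ZMod N)) (by rw [hx0, sub_self]; exact E0)
    exact this x (by simp)

theorem f_onesl (hb : 2 ≤ b) (hrec : ∀ n d, d < b → f (b * n + d) = f n + fstar d) (f0 : f 0 = 0)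
    (h1 : fstar 1 = 1) : ∀ h : ℕ, ∃ m, f m = h ∧ h ≤ m := by
  intro h
  induction h with
  | zero => exact ⟨0, f0, le_rfl⟩
  | succ h ih =>
    obtain ⟨m, hm, hle⟩ := ih
    exact ⟨b * m + 1, by rw [hrec _ _ (by omega), hm, h1], by nlinarith⟩

theorem lift_one (hb : 2 ≤ b) (hrec : ∀ n d, d < b → f (b * n + d) = f n + fstar d) (f0 : f 0 = 0)
    (h1 : fstar 1 = 1) (h B : ℕ) : ∃ H, h ≤ H ∧ ∀ n ≤ B, f (H + n) = h + f n := by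
  obtain ⟨m, hm, hle⟩ := f_onesl hb hrec f0 h1 h
  have hB : B < b ^ B := Nat.lt_pow_self (by omega)
  refine ⟨b ^ B * m, hle.trans (Nat.le_mul_of_pos_left _ (by positivity)), ?_⟩
  intro n hn
  rw [f_pow hb hrec f0 _ _ _ (by omega), hm]

theorem lift_iter (hb : 2 ≤ b) (hrec : ∀ n d, d < b → f (b * n + d) = f n + fstar d)
    (f0 : f 0 = 0) (h1 : fstar 1 = 1) (r : ℕ) :
    ∀ (h : ℕ) (S : Finset ℕ), ∃ H, h ≤ H ∧ ∀ n ∈ S, f^[r] (H + n) = h + f^[r] n := by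
  induction r with
  | zero => intro h S; exact ⟨h, le_rfl, fun n _ => rfl⟩
  | succ r ih =>
    intro h S
    obtain ⟨H1, hH1, hh⟩ := ih h (S.image f)
    obtain ⟨H, hH, hh2⟩ := lift_one hb hrec f0 h1 H1 (S.sup id)
    refine ⟨H, hH1.trans hH, fun n hn => ?_⟩
    rw [Function.iterate_succ_apply, Function.iterate_succ_apply,
      hh2 n (Finset.le_sup (f := id) hn), hh _ (Finset.mem_image_of_mem f hn)]

theorem merge_pair (hb : 2 ≤ b) (hrec : ∀ n d, d < b → f (b * n + d) = f n + fstar d)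
    (f0 : f 0 = 0) (h1 : fstar 1 = 1) (x : ℤ) (hx : DMerg f x) :
    ∀ m n : ℕ, (n : ℤ) - m = x → ∃ h r, f^[r] (h + m) = f^[r] (h + n) := by
  unfold DMerg at hx
  induction hx using Relation.ReflTransGen.head_induction_on with
  | refl => intro m n h; obtain rfl : m = n := by omega
            exact ⟨0, 0, rfl⟩
  | head hs _ ih =>
    intro m n h
    obtain ⟨e, e', he, hf⟩ := hs
    obtain ⟨H, hH, hHf⟩ := lift_one hb hrec f0 h1 m (e + e')
    obtain ⟨h2, r, hr⟩ := ih (m + f e) (m + f e') (by push_cast; omega)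
    obtain ⟨H2, -, hH2⟩ := lift_one hb hrec f0 h1 h2 (H + e + e')
    refine ⟨H2 + (H + e - m), r + 1, ?_⟩
    have a1 : H2 + (H + e - m) + m = H2 + (H + e) := by omega
    have a2 : H2 + (H + e - m) + n = H2 + (H + e') := by omega
    rw [a1, a2, Function.iterate_succ_apply, Function.iterate_succ_apply,
      hH2 _ (by omega), hH2 _ (by omega), hHf _ (by omega), hHf _ (by omega), hr]

theorem merge_set (hb : 2 ≤ b) (hrec : ∀ n d, d < b → f (b * n + d) = f n + fstar d)
    (f0 : f 0 = 0) (h1 : fstar 1 = 1) (G : AddSubgroup ℤ) (hG : ∀ n : ℕ, (f n : ℤ) - n ∈ G)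
    (hM : ∀ x ∈ G, DMerg f x) : ∀ (k : ℕ) (X : Finset ℕ), X.card ≤ k →
      (∀ x ∈ X, ∀ y ∈ X, (x : ℤ) - y ∈ G) → ∃ h r v, ∀ x ∈ X, f^[r] (h + x) = v := by
  have hGr : ∀ r n : ℕ, (f^[r] n : ℤ) - n ∈ G := by
    intro r
    induction r with
    | zero => intro n; simp
    | succ r ih =>
      intro n
      rw [Function.iterate_succ_apply]
      have := G.add_mem (ih (f n)) (hG n)
      convert this using 1; ring
  intro k
  induction k with
  | zero =>
    intro X hX _
    have : X = ∅ := Finset.card_eq_zero.1 (by omega)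
    subst this
    exact ⟨0, 0, 0, by simp⟩
  | succ k ih =>
    intro X hX hXG
    by_cases hone : X.card ≤ 1
    · rw [Finset.card_le_one] at hone
      rcases X.eq_empty_or_nonempty with rfl | ⟨y, hy⟩
      · exact ⟨0, 0, 0, by simp⟩
      · exact ⟨0, 0, y, fun x hx => by simpa using hone x hx y hy⟩
    · obtain ⟨m, hm, n, hn, hne⟩ := Finset.one_lt_card.1 (not_le.1 hone)
      obtain ⟨h, r, hr⟩ := merge_pair hb hrec f0 h1 _ (hM _ (hXG n hn m hm)) m n rfl
      set X' := X.image (fun x => f^[r] (h + x)) with hX'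
      have hc : X'.card < X.card := by
        refine lt_of_le_of_ne Finset.card_image_le fun heq => hne ?_
        exact Finset.card_image_iff.1 heq hm hn hr
      obtain ⟨h', r', v, hv⟩ := ih X' (by omega) (by
        intro x hx y hy
        obtain ⟨x, hx1, rfl⟩ := Finset.mem_image.1 hx
        obtain ⟨y, hy1, rfl⟩ := Finset.mem_image.1 hy
        have := G.add_mem (G.sub_mem (hGr r (h + x)) (hGr r (h + y))) (hXG x hx1 y hy1)
        convert this using 1
        push_cast; ring)
      obtain ⟨H, -, hH⟩ := lift_iter hb hrec f0 h1 r h' (X.image (fun x => h + x))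
      refine ⟨H + h, r' + r, v, fun x hx => ?_⟩
      rw [Function.iterate_add_apply, add_assoc, hH _ (Finset.mem_image_of_mem _ hx)]
      exact hv _ (Finset.mem_image_of_mem _ hx)

end

/-- Under the hypothesis of Lemma 2.2, for every nonempty finite
subset `X` of `D` containing `u`, there is `h_X` with `h_X + x` a `u`-integer for
all `x ∈ X`. -/
theorem stmt_6 (b : ℕ) (hb : 2 ≤ b) (fstar : ℕ → ℕ) (f : ℕ → ℕ)
    (hf : ∀ n, f n = ((Nat.digits b n).map fstar).sum)
    (h0 : fstar 0 = 0) (h1 : fstar 1 = 1)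
    (u : ℕ) (hu : 0 < u) (hcyc : ∃ r : ℕ, 1 ≤ r ∧ f^[r] u = u)
    (hyp : ∀ x : ℕ, (0 < x ∧ ∃ r : ℕ, 1 ≤ r ∧ f^[r] x = x) →
      ∃ h : ℕ, 0 < h ∧ ∃ r : ℕ, 1 ≤ r ∧ f^[r] (h + u) = u ∧ f^[r] (h + x) = u)
    (X : Finset ℕ) (hXne : X.Nonempty) (huX : u ∈ X)
    (hXD : ∀ x ∈ X, 0 < x ∧ ∃ r : ℕ, 1 ≤ r ∧ f^[r] x = x) :
    ∃ h : ℕ, 0 < h ∧ ∀ x ∈ X, ∃ r : ℕ, 1 ≤ r ∧ f^[r] (h + x) = u := by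
  have f0 : f 0 = 0 := by simp [hf]
  have hrec : ∀ n d, d < b → f (b * n + d) = f n + fstar d := by
    intro n d hd
    by_cases hz : n = 0 ∧ d = 0
    · obtain ⟨rfl, rfl⟩ := hz
      simp [f0, h0]
    · rw [hf, hf, add_comm (b * n) d, Nat.digits_add b (by omega) d n hd (by omega)]
      simp [add_comm]
  obtain ⟨G, hG, hM⟩ := core hb hrec f0 h0 h1
  have hGr : ∀ r n : ℕ, (f^[r] n : ℤ) - n ∈ G := by
    intro r
    induction r with
    | zero => intro n; simp
    | succ r ih =>
      intro n
      rw [Function.iterate_succ_apply]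
      have := G.add_mem (ih (f n)) (hG n)
      convert this using 1; ring
  have hxu : ∀ x ∈ X, (x : ℤ) - u ∈ G := by
    intro x hx
    obtain ⟨h, -, r, -, e1, e2⟩ := hyp x (hXD x hx)
    have a1 := hGr r (h + u)
    have a2 := hGr r (h + x)
    rw [e1] at a1
    rw [e2] at a2
    have := G.sub_mem a1 a2
    convert this using 1
    push_cast; ring
  obtain ⟨h, r, v, hv⟩ := merge_set hb hrec f0 h1 G hG hM _ X le_rfl (by
    intro x hx y hy
    have := G.sub_mem (hxu x hx) (hxu y hy)
    convert this using 1; ring)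
  obtain ⟨m, hm, hle⟩ := f_onesl hb hrec f0 h1 u
  have hvp : v < b ^ v := Nat.lt_pow_self (by omega)
  have hlt : v < b ^ v * m := lt_of_lt_of_le hvp (Nat.le_mul_of_pos_right _ (by omega))
  obtain ⟨H, hH, hHf⟩ := lift_iter hb hrec f0 h1 r (b ^ v * m - v) (X.image (fun x => h + x))
  refine ⟨H + h, by omega, fun x hx => ⟨r + 1, by omega, ?_⟩⟩
  rw [Function.iterate_succ_apply', add_assoc, hHf _ (Finset.mem_image_of_mem _ hx), hv x hx,
    Nat.sub_add_cancel hlt.le]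
  have := f_pow hb hrec f0 v m 0 (by positivity)
  rw [f0] at this
  simpa [hm] using this
end

section
/- Let u be a cycle number and let h be a u-integer. Then for every integer a, there exists a u-integer l such that l ≡ a (mod f_*(b-1)) and such that l and h are concurrently u-integers. -/
theorem aux_f (b : ℕ) (hb : 2 ≤ b) (fstar : ℕ → ℕ) (f : ℕ → ℕ)
    (hf : ∀ n, f n = ((Nat.digits b n).map fstar).sum)
    (h0 : fstar 0 = 0) (d m : ℕ) (hd : d < b) : f (d + b * m) = fstar d + f m := by
  by_cases hz : d = 0 ∧ m = 0
  · obtain ⟨rfl, rfl⟩ := hz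
    simp [hf, h0]
  · rw [hf, hf, Nat.digits_add b (by omega) d m hd (by omega)]
    simp

theorem aux_pow (b : ℕ) (hb : 2 ≤ b) (fstar : ℕ → ℕ) (f : ℕ → ℕ)
    (hf : ∀ n, f n = ((Nat.digits b n).map fstar).sum)
    (h0 : fstar 0 = 0) (m k : ℕ) : f (b ^ k * m) = f m := by
  induction k with
  | zero => simp
  | succ k ih =>
    have := aux_f b hb fstar f hf h0 0 (b ^ k * m) (by omega)
    rw [h0, ih] at this
    rw [pow_succ', mul_assoc]
    simpa using this

theorem aux_step (b : ℕ) (hb : 2 ≤ b) (fstar : ℕ → ℕ) (f : ℕ → ℕ)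
    (hf : ∀ n, f n = ((Nat.digits b n).map fstar).sum)
    (h0 : fstar 0 = 0) (M : ℕ) (hM : 0 < M) (hg : Nat.gcd b M = 1)
    (d : ℕ) (hd : d < b) (n s : ℕ) :
    ∃ n' : ℕ, n' ≡ n + s * d [MOD M] ∧ f n' = f n + s * fstar d := by
  induction s with
  | zero => exact ⟨n, by simp [Nat.ModEq], by simp⟩
  | succ s ih =>
    obtain ⟨n', h1, h2⟩ := ih
    have hp : b * b ^ (Nat.totient M - 1) ≡ 1 [MOD M] := by
      have := Nat.ModEq.pow_totient (x := b) (n := M) hg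
      have hpos := Nat.totient_pos.2 hM
      rwa [← pow_succ', Nat.sub_add_cancel hpos]
    refine ⟨d + b * (b ^ (Nat.totient M - 1) * n'), ?_, ?_⟩
    · rw [← mul_assoc]
      have := (hp.mul h1).add_left d
      refine this.trans ?_
      have e : d + 1 * (n + s * d) = n + (s + 1) * d := by ring
      rw [e]
    · rw [aux_f b hb fstar f hf h0 _ _ hd, aux_pow b hb fstar f hf h0, h2]
      ring

/-- Given a `u`-integer `h`, for every integer `a` there is a
`u`-integer `l ≡ a (mod f_*(b-1))` such that `l` and `h` are concurrently
`u`-integers. -/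
theorem stmt_7 (b : ℕ) (hb : 2 ≤ b) (fstar : ℕ → ℕ) (f : ℕ → ℕ)
    (hf : ∀ n, f n = ((Nat.digits b n).map fstar).sum)
    (h0 : fstar 0 = 0) (h1 : fstar 1 = 1)
    (hgcd : Nat.gcd b (fstar (b - 1)) = 1)
    (hm : ∃ mstar : ℕ, mstar ≤ b - 1 ∧
      Int.gcd ((fstar mstar : ℤ) - (mstar : ℤ)) (fstar (b - 1) : ℤ) = 1)
    (u : ℕ) (hu : 0 < u) (hcyc : ∃ r : ℕ, 1 ≤ r ∧ f^[r] u = u)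
    (h : ℕ) (hh : 0 < h) (hhu : ∃ r : ℕ, 1 ≤ r ∧ f^[r] h = u)
    (a : ℤ) :
    ∃ l : ℕ, 0 < l ∧ (l : ℤ) ≡ a [ZMOD (fstar (b - 1) : ℤ)] ∧
      ∃ r : ℕ, 1 ≤ r ∧ f^[r] l = u ∧ f^[r] h = u := by
  obtain ⟨m, hmb, hmg⟩ := hm
  obtain ⟨p, hp, hpu⟩ := hcyc
  obtain ⟨r, hr, hru⟩ := hhu
  generalize fstar (b - 1) = M at *
  have hM : 0 < M := by
    rcases Nat.eq_zero_or_pos M with rfl | h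
    · simp at hgcd; omega
    · exact h
  have hf0 : f 0 = 0 := by simp [hf]
  obtain ⟨q, hq⟩ : ∃ q, p + r = q + 1 + 1 := ⟨p + r - 2, by omega⟩
  have hR : f^[q + 1 + 1] h = u := by
    rw [← hq, Function.iterate_add_apply, hru, hpu]
  have hR' : f^[q] (f (f h)) = u := by simpa [Function.iterate_succ_apply] using hR
  have hfh : 0 < f h := by
    rcases Nat.eq_zero_or_pos (f h) with e | e
    · rw [e, hf0, Function.iterate_fixed hf0] at hR'; omega
    · exact e
  set H := b ^ (M * fstar m) * f h with hH
  have hHbig : M * fstar m < H :=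
    lt_of_lt_of_le (Nat.lt_pow_self (by omega)) (Nat.le_mul_of_pos_right _ hfh)
  have hfH : f H = f (f h) := aux_pow b hb fstar f hf h0 _ _
  have hMz : (0 : ℤ) < M := by exact_mod_cast hM
  obtain ⟨x, hx⟩ : ∃ x : ℤ, ((fstar m : ℤ) - m) * x ≡ 1 [ZMOD M] := by
    obtain ⟨x, y, hxy⟩ := Int.isCoprime_iff_gcd_eq_one.2 hmg
    refine ⟨x, (Int.modEq_iff_dvd).2 ⟨y, ?_⟩⟩
    linear_combination -hxy
  obtain ⟨s, hs⟩ : ∃ s : ℕ, (s : ℤ) = (x * (H - a)) % M :=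
    ⟨((x * (H - a)) % M).toNat, Int.toNat_of_nonneg (Int.emod_nonneg _ hMz.ne')⟩
  have hsM : s < M := by
    have := Int.emod_lt_of_pos (x * (H - a)) hMz
    omega
  have hsmod : ((fstar m : ℤ) - m) * s ≡ H - a [ZMOD M] := by
    rw [hs]
    refine ((Int.mod_modEq _ _).mul_left _).trans ?_
    have := hx.mul_right (H - a)
    rwa [mul_assoc, one_mul] at this
  have hle : s * fstar m ≤ H := (Nat.mul_le_mul_right _ hsM.le).trans hHbig.le
  obtain ⟨t, ht⟩ := Nat.exists_eq_add_of_le hle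
  obtain ⟨n, hn1, hn2⟩ := aux_step b hb fstar f hf h0 M hM hgcd m (by omega) 0 s
  obtain ⟨l, hl1, hl2⟩ := aux_step b hb fstar f hf h0 M hM hgcd 1 (by omega) n t
  have hfl : f l = H := by rw [hl2, hn2, hf0, h1, ht]; ring
  refine ⟨l, ?_, ?_, q + 1 + 1, by omega, ?_, hR⟩
  · rcases Nat.eq_zero_or_pos l with e | e
    · rw [e, hf0] at hfl; omega
    · exact e
  · have hl3 : l ≡ s * m + t [MOD M] := by
      have := hl1.trans (hn1.add_right _)
      simpa using this
    have hl4 : (l : ℤ) ≡ s * m + t [ZMOD M] := by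
      exact_mod_cast (Int.natCast_modEq_iff.2 hl3)
    refine hl4.trans ?_
    have hHz : (H : ℤ) = s * fstar m + t := by exact_mod_cast ht
    have := (Int.ModEq.refl (n := (M : ℤ)) (H : ℤ)).sub hsmod
    have e1 : (H : ℤ) - ((fstar m : ℤ) - m) * s = s * m + t := by rw [hHz]; ring
    have e2 : (H : ℤ) - (H - a) = a := by ring
    rwa [e1, e2] at this
  · rw [Function.iterate_succ_apply, Function.iterate_succ_apply, hfl, hfH, hR']
end

section
/- For every integer a and every positive integer l_1 with l_1 > f_*(b-1) · f_*(m_*), there exists a positive integer l_2 such that f(l_2) = l_1 and l_2 ≡ a (mod f_*(b-1)). -/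
/-- For every integer `a` and every `l₁ > f_*(b-1)·f_*(m_*)`, there
is `l₂ > 0` with `f l₂ = l₁` and `l₂ ≡ a (mod f_*(b-1))`. -/
theorem stmt_8 (b : ℕ) (hb : 2 ≤ b) (fstar : ℕ → ℕ) (f : ℕ → ℕ)
    (hf : ∀ n, f n = ((Nat.digits b n).map fstar).sum)
    (h0 : fstar 0 = 0) (h1 : fstar 1 = 1)
    (hgcd : Nat.gcd b (fstar (b - 1)) = 1)
    (mstar : ℕ) (hmstar : mstar ≤ b - 1)
    (hcop : Int.gcd ((fstar mstar : ℤ) - (mstar : ℤ)) (fstar (b - 1) : ℤ) = 1)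
    (a : ℤ) (l₁ : ℕ) (hl₁ : fstar (b - 1) * fstar mstar < l₁) :
    ∃ l₂ : ℕ, 0 < l₂ ∧ f l₂ = l₁ ∧ (l₂ : ℤ) ≡ a [ZMOD (fstar (b - 1) : ℤ)] := by
  have hF : ∀ x y, x < b → f (x + b * y) = fstar x + f y := by
    intro x y hx
    by_cases h : x ≠ 0 ∨ y ≠ 0
    · rw [hf, hf, Nat.digits_add b (by omega) x y hx h]
      simp
    · push Not at h
      obtain ⟨rfl, rfl⟩ := h
      simp [h0]
  have hP : ∀ k y, f (b ^ k * y) = f y := by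
    intro k y
    induction k with
    | zero => simp
    | succ k ih =>
      have := hF 0 (b ^ k * y) (by omega)
      rw [h0, zero_add, zero_add, ih] at this
      rw [← this]
      congr 1
      ring
  have hq : 0 < fstar (b - 1) := by
    rcases Nat.eq_zero_or_pos (fstar (b - 1)) with h | h
    · rw [h, Nat.gcd_zero_right] at hgcd
      omega
    · exact h
  generalize fstar (b - 1) = q at *
  obtain ⟨k, hk⟩ : ∃ k, Nat.totient q = k + 1 :=
    Nat.exists_eq_add_one_of_ne_zero (Nat.totient_pos.2 hq).ne'
  have hpow : ((b : ℤ)) ^ (k + 1) ≡ 1 [ZMOD q] := by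
    have := Nat.ModEq.pow_totient (x := b) (n := q) hgcd
    rw [hk] at this
    exact_mod_cast (Int.natCast_modEq_iff.2 this)
  have step : ∀ d, d < b → ∀ n : ℕ, ∃ n' : ℕ, f n' = f n + fstar d ∧
      (n' : ℤ) ≡ n + d [ZMOD q] := by
    intro d hd n
    refine ⟨d + b * (b ^ k * n), ?_, ?_⟩
    · rw [hF _ _ hd, hP, add_comm]
    · have := ((hpow.mul_right (n : ℤ)).add_right (d : ℤ))
      rw [one_mul] at this
      refine Eq.trans ?_ this
      congr 1
      push_cast
      ring
  have steps : ∀ d, d < b → ∀ n j : ℕ, ∃ n' : ℕ, f n' = f n + j * fstar d ∧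
      (n' : ℤ) ≡ n + j * d [ZMOD q] := by
    intro d hd n j
    induction j with
    | zero => exact ⟨n, by simp, by simp [Int.ModEq]⟩
    | succ j ih =>
      obtain ⟨n1, e1, c1⟩ := ih
      obtain ⟨n2, e2, c2⟩ := step d hd n1
      refine ⟨n2, by rw [e2, e1]; ring, c2.trans ((c1.add_right _).trans ?_)⟩
      push_cast
      ring_nf
      rfl
  obtain ⟨u, v, huv⟩ := Int.isCoprime_iff_gcd_eq_one.2 hcop
  have hqz : (0 : ℤ) < q := by exact_mod_cast hq
  obtain ⟨j, hj⟩ := Int.eq_ofNat_of_zero_le (Int.emod_nonneg (u * (l₁ - a)) hqz.ne')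
  have hjq : j < q := by
    have := Int.emod_lt_of_pos (u * (l₁ - a)) hqz
    rw [hj] at this
    exact_mod_cast this
  have hjc : (j : ℤ) ≡ u * (l₁ - a) [ZMOD q] := by
    rw [← hj]
    exact Int.mod_modEq _ _
  have hle : j * fstar mstar ≤ l₁ :=
    (Nat.mul_le_mul_right _ hjq.le).trans hl₁.le
  obtain ⟨n1, e1, c1⟩ := steps mstar (by omega) 0 j
  obtain ⟨n2, e2, c2⟩ := steps 1 (by omega) n1 (l₁ - j * fstar mstar)
  have hf0 : f 0 = 0 := by simp [hf]
  have e3 : f n2 = l₁ := by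
    rw [e2, e1, hf0, h1]
    omega
  refine ⟨n2, ?_, e3, ?_⟩
  · rcases Nat.eq_zero_or_pos n2 with h | h
    · rw [h, hf0] at e3
      omega
    · exact h
  · refine c2.trans ((c1.add_right _).trans ?_)
    rw [Nat.cast_sub hle]
    push_cast
    have h3 := (hjc.mul_right ((fstar mstar : ℤ) - mstar)).dvd
    obtain ⟨w, hw⟩ := h3
    apply Int.modEq_of_dvd
    refine ⟨- w - v * (l₁ - a), ?_⟩
    linear_combination (-1 : ℤ) * hw + (l₁ - a : ℤ) * huv
end

section
/- Let u be a cycle number. Then for each positive integer x, there exists a u-integer l such that l and l + x are concurrently u-integers. -/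
theorem aux_f0 {b : ℕ} (hb : 2 ≤ b) {fstar f : ℕ → ℕ}
    (hf : ∀ n, f n = ((Nat.digits b n).map fstar).sum) (h0 : fstar 0 = 0)
    (a d : ℕ) (hd : d < b) : f (b * a + d) = f a + fstar d := by
  rcases Nat.eq_zero_or_pos (b * a + d) with h | h
  · have hd0 : d = 0 := by omega
    have ha : a = 0 := by
      have : b * a = 0 := by omega
      rcases Nat.mul_eq_zero.1 this with h | h <;> omega
    subst hd0 ha
    simp [h0]
  · rw [hf, hf, Nat.digits_def' (by omega) h]
    have e1 : (b * a + d) % b = d := by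
      rw [Nat.mul_add_mod]; exact Nat.mod_eq_of_lt hd
    have e2 : (b * a + d) / b = a := by
      rw [Nat.mul_add_div (by omega), Nat.div_eq_of_lt hd]; rfl
    rw [e1, e2]
    simp [add_comm]

theorem aux_add {b : ℕ} (hb : 2 ≤ b) {f fstar : ℕ → ℕ}
    (hs : ∀ a d, d < b → f (b * a + d) = f a + fstar d) (hz : f 0 = 0) (k : ℕ) :
    ∀ a c, c < b ^ k → f (b ^ k * a + c) = f a + f c := by
  induction k with
  | zero => intro a c hc; simp at hc; subst hc; simp [hz]
  | succ k ih =>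
    intro a c hc
    have hlt : c % b < b := Nat.mod_lt _ (by omega)
    have hdiv : c / b < b ^ k := by
      rw [Nat.div_lt_iff_lt_mul (by omega)]; rwa [pow_succ] at hc
    have e := Nat.div_add_mod c b
    have : b ^ (k + 1) * a + c = b * (b ^ k * a + c / b) + c % b := by
      rw [← Nat.div_add_mod c b, pow_succ]
      rw [e]
      nlinarith
    rw [this, hs _ _ hlt, ih _ _ hdiv]
    conv_rhs => rw [← e, hs _ _ hlt]
    ring

theorem stmt_9 (b : ℕ) (hb : 2 ≤ b) (fstar : ℕ → ℕ) (f : ℕ → ℕ)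
    (hf : ∀ n, f n = ((Nat.digits b n).map fstar).sum)
    (h0 : fstar 0 = 0) (h1 : fstar 1 = 1)
    (hgcd : Nat.gcd b (fstar (b - 1)) = 1)
    (hm : ∃ mstar : ℕ, mstar ≤ b - 1 ∧
      Int.gcd ((fstar mstar : ℤ) - (mstar : ℤ)) (fstar (b - 1) : ℤ) = 1)
    (u : ℕ) (hu : 0 < u) (hcyc : ∃ r : ℕ, 1 ≤ r ∧ f^[r] u = u)
    (x : ℕ) (hx : 0 < x) :
    ∃ l : ℕ, 0 < l ∧ ∃ r : ℕ, 1 ≤ r ∧ f^[r] l = u ∧ f^[r] (l + x) = u := by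
  have hs := aux_f0 hb hf h0
  have hz : f 0 = 0 := by simp [hf]
  have hadd := aux_add hb hs hz
  have hdig : ∀ d, d < b → f d = fstar d := by
    intro d hd
    have := hs 0 d hd
    simpa [hz] using this
  have hshift : ∀ k a, f (b ^ k * a) = f a := by
    intro k a
    have := hadd k a 0 (by positivity)
    simpa [hz] using this
  have hpow : ∀ k, f (b ^ k) = 1 := by
    intro k
    have := hshift k 1
    rw [mul_one, hdig 1 (by omega), h1] at this
    exact this
  have hpos : ∀ k, 1 ≤ b ^ k := fun k => Nat.one_le_pow _ _ (by omega)
  have hnine : ∀ t, f (b ^ t - 1) = t * fstar (b - 1) := by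
    intro t
    induction t with
    | zero => simp [hz]
    | succ t ih =>
      have : b ^ (t + 1) - 1 = b * (b ^ t - 1) + (b - 1) := by
        obtain ⟨v, hv⟩ := Nat.exists_eq_add_of_le (hpos t)
        rw [pow_succ, hv, Nat.add_sub_cancel_left]
        have : (1 + v) * b = b * v + b := by ring
        omega
      rw [this, hs _ _ (by omega), ih]; ring
  have hsurj : ∀ n, ∃ q, f q = n := by
    intro n
    induction n with
    | zero => exact ⟨0, hz⟩
    | succ n ih =>
      obtain ⟨q, hq⟩ := ih
      exact ⟨b * q + 1, by rw [hs _ _ (by omega), hq, h1]⟩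
  have hlt : ∀ n, n < b ^ n := fun n => Nat.lt_pow_self (by omega)
  let P : ℕ → Prop := fun y => ∀ N, ∃ l, N ≤ l ∧ ∃ r, 1 ≤ r ∧ f^[r] l = u ∧ f^[r] (l + y) = u
  have hP0 : P 0 := by
    intro N
    obtain ⟨r, hr, hru⟩ := hcyc
    have e : f^[r] (b ^ N * u) = u := by
      obtain ⟨s, rfl⟩ := Nat.exists_eq_add_of_le' hr
      rw [Function.iterate_succ_apply, hshift, ← Function.iterate_succ_apply, hru]
    refine ⟨b ^ N * u, ?_, r, hr, e, e⟩
    have := hlt N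
    nlinarith
  have hstep : ∀ x y l, P y → (f (l + x) = f l + y ∨ f l = f (l + x) + y) → P x := by
    intro x y l hy h N
    obtain ⟨l', hl', r, hr, e1, e2⟩ := hy (f l + f (l + x) + 1)
    obtain ⟨q, hq⟩ := hsurj (l' - min (f l) (f (l + x)))
    have hq1 : 1 ≤ q := by
      rcases Nat.eq_zero_or_pos q with h | h
      · subst h; omega
      · exact h
    have hk := hlt (l + x + N)
    set k := l + x + N with hkd
    have a1 := hadd k q l (by omega)
    have a2 := hadd k q (l + x) (by omega)
    refine ⟨b ^ k * q + l, by nlinarith, r + 1, by omega, ?_, ?_⟩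
    · rw [Function.iterate_succ_apply, a1]
      rcases h with h | h
      · rw [show f q + f l = l' by omega]; exact e1
      · rw [show f q + f l = l' + y by omega]; exact e2
    · rw [Function.iterate_succ_apply, add_assoc, a2]
      rcases h with h | h
      · rw [show f q + f (l + x) = l' + y by omega]; exact e2
      · rw [show f q + f (l + x) = l' by omega]; exact e1
  obtain ⟨m, hmb, hmc⟩ := hm
  set F := fstar (b - 1) with hF
  have hFpos : 0 < F := by
    rcases Nat.eq_zero_or_pos F with h | h
    · rw [h] at hgcd; simp at hgcd; omega
    · exact h
  haveI : NeZero F := ⟨by omega⟩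
  have hbF : ∀ K, ((b : ZMod F)) ^ (F.totient * K) = 1 := by
    intro K
    have := Nat.ModEq.pow_totient (n := F) (x := b) hgcd
    have h2 := (ZMod.natCast_eq_natCast_iff _ _ _).2 this
    push_cast at h2
    rw [pow_mul, h2, one_pow]
  have hbig : ∀ K, K < b ^ (F.totient * K) := by
    intro K
    have : 0 < F.totient := Nat.totient_pos.2 hFpos
    calc K < b ^ K := hlt K
      _ ≤ _ := Nat.pow_le_pow_right (by omega) (by nlinarith)
  have happ : ∀ d, d < b → ∀ x0 : ℕ, ∃ x1 : ℕ, (x1 : ZMod F) = x0 + d ∧ f x1 = f x0 + fstar d := by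
    intro d hd x0
    refine ⟨b ^ (F.totient * x0) * d + x0, ?_, ?_⟩
    · push_cast; rw [hbF]; ring
    · rw [hadd _ _ _ (hbig x0), hdig d hd]; ring
  have happs : ∀ d, d < b → ∀ w x0 : ℕ, ∃ x1 : ℕ, (x1 : ZMod F) = x0 + w * d ∧ f x1 = f x0 + w * fstar d := by
    intro d hd w x0
    induction w with
    | zero => exact ⟨x0, by simp, by simp⟩
    | succ w ih =>
      obtain ⟨x1, g1, g2⟩ := ih
      obtain ⟨x2, g3, g4⟩ := happ d hd x1
      exact ⟨x2, by rw [g3, g1]; push_cast; ring, by rw [g4, g2]; ring⟩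
  have hcop : ∃ i : ZMod F, ((fstar m : ZMod F) - m) * i = 1 := by
    have h3 : IsCoprime ((fstar m : ℤ) - m) (F : ℤ) := Int.isCoprime_iff_gcd_eq_one.2 hmc
    obtain ⟨p, q, hpq⟩ := h3
    have := congrArg (Int.cast : ℤ → ZMod F) hpq
    push_cast at this
    refine ⟨p, ?_⟩
    simp at this
    rw [mul_comm]; exact this
  obtain ⟨i, hi⟩ := hcop
  have hy : ∀ (ρ : ZMod F) (M : ℕ), ∃ y : ℕ, M ≤ y ∧ (y : ZMod F) = ρ ∧ P y := by
    intro ρ M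
    set w := (-ρ * i).val with hw
    have hw' : (w : ZMod F) = -ρ * i := ZMod.natCast_zmod_val _
    set s := (-(1 + w * fstar m) : ZMod F).val with hsd
    have hs' : (s : ZMod F) = -(1 + w * fstar m) := ZMod.natCast_zmod_val _
    obtain ⟨x1, g1, g2⟩ := happs m (by omega) w 0
    obtain ⟨x0, g3, g4⟩ := happs 1 (by omega) s x1
    have hK := hbig (x0 + M)
    have hKF := hbF (x0 + M)
    set k := F.totient * (x0 + M)
    refine ⟨b ^ k + x0, by omega, ?_, ?_⟩
    · push_cast
      rw [hKF, g3, g1, hs', hw']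
      push_cast
      linear_combination ρ * hi
    · have hdvd : F ∣ 1 + f x0 := by
        rw [← ZMod.natCast_eq_zero_iff, g4, g2, hz, h1]
        push_cast
        rw [hs']; ring
      obtain ⟨t, ht⟩ := hdvd
      refine hstep _ 0 (b ^ k * (b ^ t - 1)) hP0 (Or.inl ?_)
      have e : b ^ k * (b ^ t - 1) + (b ^ k + x0) = b ^ k * b ^ t + x0 := by
        obtain ⟨v, hv⟩ := Nat.exists_eq_add_of_le (hpos t)
        rw [hv, Nat.add_sub_cancel_left]; ring
      rw [e, hadd _ _ _ (by omega), hpow, hshift, hnine, ht]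
      ring
  have hPx : P x := by
    have hxk := hlt x
    obtain ⟨y, hy1, hy2, hy3⟩ := hy ((f (b ^ x - x) : ZMod F) - 1) (f (b ^ x - x))
    have : ((f (b ^ x - x) : ℕ) : ZMod F) = ((y + 1 : ℕ) : ZMod F) := by
      push_cast; rw [hy2]; ring
    rw [ZMod.natCast_eq_natCast_iff, Nat.modEq_iff_dvd' (by omega)] at this
    obtain ⟨j, hj⟩ := this
    refine hstep x y (b ^ x * (b ^ j - 1) + (b ^ x - x)) hy3 (Or.inr ?_)
    have e : b ^ x * (b ^ j - 1) + (b ^ x - x) + x = b ^ x * b ^ j := by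
      rw [add_assoc, Nat.sub_add_cancel hxk.le]
      obtain ⟨v, hv⟩ := Nat.exists_eq_add_of_le (hpos j)
      rw [hv, Nat.add_sub_cancel_left]; ring
    rw [e, hshift, hpow, hadd _ _ _ (by omega), hnine, mul_comm j]
    omega
  obtain ⟨l, hl, r, h⟩ := hPx 1
  exact ⟨l, hl, r, h⟩
end

section
/- Let b ≥ 2 and e ≥ 1 be integers, and suppose that for every prime p dividing b - 1, p - 1 does not divide e - 1. Then there exists an integer g with 0 ≤ g ≤ b - 1 such that g^e - g is coprime to b - 1 (equivalently, coprime to (b-1)^e). -/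
theorem aux_gen (p : ℕ) : ∃ r : ℕ, p.Prime → ∀ e : ℕ, 1 ≤ e →
    (r : ZMod p) ^ e = (r : ZMod p) → p - 1 ∣ e - 1 := by
  by_cases h : p.Prime
  · haveI : Fact p.Prime := ⟨h⟩
    obtain ⟨u, hu⟩ := IsCyclic.exists_generator (α := (ZMod p)ˣ)
    refine ⟨(u : ZMod p).val, fun _ e he hr => ?_⟩
    rw [ZMod.natCast_zmod_val] at hr
    have h1 : u ^ e = u := by ext; simpa using hr
    obtain ⟨k, rfl⟩ := Nat.exists_eq_add_of_le' he
    have h2 : u ^ k = 1 := by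
      rw [pow_succ] at h1
      exact mul_eq_right.mp h1
    have h3 := orderOf_dvd_of_pow_eq_one h2
    rw [orderOf_eq_card_of_forall_mem_zpowers hu, Nat.card_eq_fintype_card, ZMod.card_units] at h3
    simpa using h3
  · exact ⟨0, fun h' => absurd h' h⟩

/-- If for every prime `p ∣ b - 1` we have `p - 1 ∤ e - 1`, then
there is a digit `g ≤ b - 1` with `g^e - g` coprime to `b - 1`. -/
theorem stmt_12 (b e : ℕ) (hb : 2 ≤ b) (he : 1 ≤ e)
    (hp : ∀ p : ℕ, p.Prime → p ∣ b - 1 → ¬ (p - 1 ∣ e - 1)) :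
    ∃ g : ℕ, g ≤ b - 1 ∧ Int.gcd ((g : ℤ) ^ e - (g : ℤ)) ((b : ℤ) - 1) = 1 := by
  choose r hr using aux_gen
  obtain ⟨n, rfl⟩ := Nat.exists_eq_add_of_le' (show 1 ≤ b by omega)
  simp only [Nat.add_sub_cancel] at hp ⊢
  have hn : 0 < n := by omega
  obtain ⟨k, hk⟩ := Nat.chineseRemainderOfFinset r (fun p => p) n.primeFactors
    (fun p hp => (Nat.prime_of_mem_primeFactors hp).ne_zero)
    (fun p hp q hq hpq => (Nat.coprime_primes (Nat.prime_of_mem_primeFactors hp)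
      (Nat.prime_of_mem_primeFactors hq)).2 hpq)
  refine ⟨k % n, (Nat.mod_lt _ hn).le, ?_⟩
  by_contra hne
  obtain ⟨p, hpp, hpd⟩ := Nat.exists_prime_and_dvd hne
  have hd : (p : ℤ) ∣ _ := Int.natCast_dvd_natCast.2 hpd
  have h1 := hd.trans (Int.gcd_dvd_left _ _)
  have h2 := hd.trans (Int.gcd_dvd_right _ _)
  have hpn : p ∣ n := by
    push_cast at h2
    rw [add_sub_cancel_right] at h2
    exact_mod_cast h2
  refine hp p hpp hpn (hr p hpp e he ?_)
  have h3 : k % n ≡ r p [MOD p] :=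
    ((Nat.mod_modEq k n).of_dvd hpn).trans (hk p (Nat.mem_primeFactors.2 ⟨hpp, hpn, hn.ne'⟩))
  rw [← (ZMod.natCast_eq_natCast_iff _ _ _).2 h3]
  have h4 := (ZMod.intCast_zmod_eq_zero_iff_dvd _ p).2 h1
  rw [Int.cast_sub, Int.cast_pow, Int.cast_natCast] at h4
  exact sub_eq_zero.1 h4
end

section
/- Fix integers b ≥ 2 and e ≥ 1 such that for every prime p dividing b - 1, p - 1 does not divide e - 1. Let f be the digit map induced by f_*(m) = m^e in base b. Then for any cycle number u of f and any positive integer n, there exists a positive integer l such that l+1, l+2, ..., l+n are all u-integers. -/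
namespace DigMap

theorem exists_g (q e : ℕ) (hq : 1 ≤ q) (he : 1 ≤ e)
    (hp : ∀ p : ℕ, p.Prime → p ∣ q → ¬ (p - 1 ∣ e - 1)) :
    ∃ g : ℕ, g < q + 1 ∧ IsUnit ((g : ZMod q) ^ e - (g : ZMod q)) := by
  have loc : ∀ p : ℕ, ∃ a : ℕ, p.Prime → p ∣ q → ¬ ((a : ZMod p) ^ e - (a : ZMod p) = 0) := by
    intro p
    by_cases h : p.Prime ∧ p ∣ q
    · obtain ⟨h1, h2⟩ := h
      haveI : Fact p.Prime := ⟨h1⟩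
      obtain ⟨γ, hγ⟩ := IsCyclic.exists_generator (α := (ZMod p)ˣ)
      have ho := orderOf_eq_card_of_forall_mem_zpowers hγ
      rw [Nat.card_eq_fintype_card, ZMod.card_units] at ho
      refine ⟨(γ : ZMod p).val, fun _ _ h0 => hp p h1 h2 ?_⟩
      rw [ZMod.natCast_zmod_val] at h0
      rw [← ho]
      apply orderOf_dvd_of_pow_eq_one
      have h3 : γ ^ e = γ := by
        ext
        push_cast
        exact sub_eq_zero.mp h0
      obtain ⟨k, rfl⟩ : ∃ k, e = k + 1 := ⟨e - 1, by omega⟩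
      rw [pow_succ] at h3
      simpa using h3
    · exact ⟨0, fun h1 h2 => absurd ⟨h1, h2⟩ h⟩
  choose a ha using loc
  have hcop : Set.Pairwise (q.primeFactors : Set ℕ) (Function.onFun Nat.Coprime (fun p : ℕ => p)) := by
    intro x hx y hy hxy
    exact (Nat.coprime_primes (Nat.prime_of_mem_primeFactors hx)
      (Nat.prime_of_mem_primeFactors hy)).2 hxy
  obtain ⟨k, hk⟩ := Nat.chineseRemainderOfFinset a (fun p => p) q.primeFactors
    (fun p hp => (Nat.prime_of_mem_primeFactors hp).ne_zero) hcop
  refine ⟨k % q, by have := Nat.mod_lt k (show q > 0 by omega); omega, ?_⟩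
  rw [ZMod.natCast_mod]
  have : ((k : ZMod q) ^ e - (k : ZMod q)) = (((k : ℤ) ^ e - k : ℤ) : ZMod q) := by push_cast; rfl
  rw [this, ZMod.coe_int_isUnit_iff_isCoprime]
  rw [Int.isCoprime_iff_gcd_eq_one]
  by_contra hne
  obtain ⟨p, hpp, hpd⟩ := Nat.exists_prime_and_dvd hne
  have h1 : (p : ℤ) ∣ (q : ℤ) := (Int.natCast_dvd_natCast.2 hpd).trans (Int.gcd_dvd_left ..)
  have h2 : (p : ℤ) ∣ (k : ℤ) ^ e - k := (Int.natCast_dvd_natCast.2 hpd).trans (Int.gcd_dvd_right ..)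
  have h1' : p ∣ q := Int.natCast_dvd_natCast.1 h1
  apply ha p hpp h1'
  have h3 := hk p (Nat.mem_primeFactors.2 ⟨hpp, h1', by omega⟩)
  have h4 : (k : ZMod p) = (a p : ZMod p) := (ZMod.natCast_eq_natCast_iff _ _ _).2 h3
  rw [← h4]
  have h5 := (ZMod.intCast_zmod_eq_zero_iff_dvd _ p).2 h2
  push_cast at h5
  exact h5

section
variable {b e : ℕ} (hb : 2 ≤ b) (he : 1 ≤ e) {f : ℕ → ℕ}
  (hf : ∀ n, f n = ((Nat.digits b n).map (· ^ e)).sum)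

theorem f_zero {b e : ℕ} {f : ℕ → ℕ}
    (hf : ∀ n, f n = ((Nat.digits b n).map (· ^ e)).sum) : f 0 = 0 := by
  rw [hf]; simp

theorem f_rec {b e : ℕ} (hb : 2 ≤ b) (he : 1 ≤ e) {f : ℕ → ℕ}
    (hf : ∀ n, f n = ((Nat.digits b n).map (· ^ e)).sum) (n r : ℕ) (hr : r < b) :
    f (r + b * n) = r ^ e + f n := by
  by_cases h : r ≠ 0 ∨ n ≠ 0
  · rw [hf, hf, Nat.digits_add b (by omega) r n hr h]; simp
  · push Not at h
    obtain ⟨rfl, rfl⟩ := h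
    simp [f_zero hf, show e ≠ 0 by omega]

theorem f_add {b e : ℕ} (hb : 2 ≤ b) (he : 1 ≤ e) {f : ℕ → ℕ}
    (hf : ∀ n, f n = ((Nat.digits b n).map (· ^ e)).sum) (a : ℕ) :
    ∀ (s c : ℕ), c < b ^ s → f (b ^ s * a + c) = f a + f c := by
  intro s
  induction s with
  | zero => intro c hc; simp at hc; subst hc; simp [f_zero hf]
  | succ s ih =>
    intro c hc
    have h1 : c / b < b ^ s := Nat.div_lt_of_lt_mul (by rw [pow_succ'] at hc; exact hc)
    have h2 : b ^ (s+1) * a + c = c % b + b * (b ^ s * a + c / b) := by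
      conv_lhs => rw [← Nat.mod_add_div c b]
      ring
    have h4 := Nat.mod_lt c (show b > 0 by omega)
    have h3 : f c = (c % b) ^ e + f (c / b) := by
      conv_lhs => rw [← Nat.mod_add_div c b]
      exact f_rec hb he hf _ _ h4
    rw [h2, f_rec hb he hf _ _ h4, ih _ h1, h3]
    ring

theorem f_digit {b e : ℕ} (hb : 2 ≤ b) (he : 1 ≤ e) {f : ℕ → ℕ}
    (hf : ∀ n, f n = ((Nat.digits b n).map (· ^ e)).sum) (r : ℕ) (hr : r < b) : f r = r ^ e := by
  have := f_rec hb he hf 0 r hr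
  simpa [f_zero hf] using this

theorem f_mulb {b e : ℕ} (hb : 2 ≤ b) (he : 1 ≤ e) {f : ℕ → ℕ}
    (hf : ∀ n, f n = ((Nat.digits b n).map (· ^ e)).sum) (s a : ℕ) : f (b ^ s * a) = f a := by
  have := f_add hb he hf a s 0 (by positivity)
  simpa [f_zero hf] using this

theorem ones {b e : ℕ} (hb : 2 ≤ b) (he : 1 ≤ e) {f : ℕ → ℕ}
    (hf : ∀ n, f n = ((Nat.digits b n).map (· ^ e)).sum) (x : ℕ) : ∃ R, f R = x ∧ x ≤ R := by
  induction x with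
  | zero => exact ⟨0, f_zero hf, le_refl _⟩
  | succ x ih =>
    obtain ⟨R, hR, hx⟩ := ih
    refine ⟨1 + b * R, ?_, ?_⟩
    · rw [f_rec hb he hf _ _ (by omega), hR]; simp; omega
    · nlinarith

theorem shift1 {b e : ℕ} (hb : 2 ≤ b) (he : 1 ≤ e) {f : ℕ → ℕ}
    (hf : ∀ n, f n = ((Nat.digits b n).map (· ^ e)).sum) (x M : ℕ) :
    ∃ l, ∀ z ≤ M, f (l + z) = x + f z := by
  obtain ⟨R, hR, -⟩ := ones hb he hf x
  refine ⟨b ^ M * R, fun z hz => ?_⟩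
  rw [f_add hb he hf R M z (lt_of_le_of_lt hz (Nat.lt_pow_self (by omega))), hR]

theorem shift {b e : ℕ} (hb : 2 ≤ b) (he : 1 ≤ e) {f : ℕ → ℕ}
    (hf : ∀ n, f n = ((Nat.digits b n).map (· ^ e)).sum) (r : ℕ) : ∀ (x M : ℕ),
    ∃ l, ∀ z ≤ M, f^[r] (l + z) = x + f^[r] z := by
  induction r with
  | zero => intro x M; exact ⟨x, fun z _ => rfl⟩
  | succ r ih =>
    intro x M
    obtain ⟨l1, h1⟩ := ih x (∑ z ∈ Finset.range (M+1), f z)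
    obtain ⟨l, hl⟩ := shift1 hb he hf l1 M
    refine ⟨l, fun z hz => ?_⟩
    rw [Function.iterate_succ_apply, Function.iterate_succ_apply, hl z hz, h1]
    exact Finset.single_le_sum (f := f) (fun _ _ => Nat.zero_le _)
      (Finset.mem_range.2 (by omega))

def Mg (f : ℕ → ℕ) (x y : ℕ) : Prop := ∃ h r, f^[r] (h + x) = f^[r] (h + y)

theorem Mg.symm {f : ℕ → ℕ} {x y : ℕ} (h : Mg f x y) : Mg f y x := by
  obtain ⟨h, r, hh⟩ := h
  exact ⟨h, r, hh.symm⟩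

theorem transfer {b e : ℕ} (hb : 2 ≤ b) (he : 1 ≤ e) {f : ℕ → ℕ}
    (hf : ∀ n, f n = ((Nat.digits b n).map (· ^ e)).sum) (k x y : ℕ)
    (h : Mg f (f (k + x)) (f (k + y))) : Mg f x y := by
  obtain ⟨h, r, hh⟩ := h
  obtain ⟨l, hl⟩ := shift1 hb he hf h (k + x + y)
  refine ⟨l + k, r + 1, ?_⟩
  rw [Function.iterate_succ_apply, Function.iterate_succ_apply, add_assoc, add_assoc,
    hl _ (by omega), hl _ (by omega), hh]

theorem merge3 {b e : ℕ} (hb : 2 ≤ b) (he : 1 ≤ e) {f : ℕ → ℕ}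
    (hf : ∀ n, f n = ((Nat.digits b n).map (· ^ e)).sum) (x d : ℕ) (hd : b - 1 ∣ d) :
    Mg f x (x + d) := by
  obtain ⟨k, rfl⟩ := hd
  obtain ⟨q, rfl⟩ : ∃ q, b = q + 1 := ⟨b - 1, by omega⟩
  have hs : (q+1) * k + x < (q+1) ^ ((q+1) * k + x) := Nat.lt_pow_self (by omega)
  set s := (q+1) * k + x with hsd
  have hk : k ≤ (q+1) * k := by nlinarith
  refine ⟨(q+1) ^ s + k - x, 1, ?_⟩
  have e1 : (q+1) ^ s + k - x + x = (q+1) ^ s * 1 + k := by omega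
  have e2 : (q+1) ^ s + k - x + (x + (q + 1 - 1) * k) = (q+1) ^ s * 1 + (q+1) * k := by
    rw [← add_assoc, e1, Nat.add_sub_cancel]; ring
  rw [e1, e2]
  simp only [Function.iterate_one]
  rw [f_add hb he hf _ _ _ (by omega), f_add hb he hf _ _ _ (by omega)]
  have := f_mulb hb he hf 1 k
  rw [pow_one] at this
  rw [this]

theorem merge2 {b e : ℕ} (hb : 2 ≤ b) (he : 1 ≤ e) {f : ℕ → ℕ}
    (hf : ∀ n, f n = ((Nat.digits b n).map (· ^ e)).sum) (x d : ℕ) (hd : b - 1 ∣ f d) :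
    Mg f x (x + d) := by
  have hs : x + d < b ^ (x + d) := Nat.lt_pow_self (by omega)
  set s := x + d with hsd
  apply transfer hb he hf (b ^ s - x)
  have e1 : b ^ s - x + x = b ^ s * 1 + 0 := by omega
  have e2 : b ^ s - x + s = b ^ s * 1 + d := by omega
  rw [e1, e2, f_add hb he hf _ _ _ (by omega), f_add hb he hf _ _ _ (by omega), f_zero hf]
  exact merge3 hb he hf _ _ hd

theorem f_nines {b e : ℕ} (hb : 2 ≤ b) (he : 1 ≤ e) {f : ℕ → ℕ}
    (hf : ∀ n, f n = ((Nat.digits b n).map (· ^ e)).sum) (j : ℕ) :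
    f (b ^ j - 1) = j * (b - 1) ^ e := by
  induction j with
  | zero => simp [f_zero hf]
  | succ j ih =>
    have hpos : 1 ≤ b ^ j := Nat.one_le_pow _ _ (by omega)
    have : b ^ (j+1) - 1 = (b - 1) + b * (b ^ j - 1) := by
      obtain ⟨m, hm⟩ : ∃ m, b ^ j = m + 1 := ⟨b ^ j - 1, by omega⟩
      rw [pow_succ', hm, Nat.add_sub_cancel, mul_add]; omega
    rw [this, f_rec hb he hf _ _ (by omega), ih]; ring

theorem append1 {b e : ℕ} (hb : 2 ≤ b) (he : 1 ≤ e) {f : ℕ → ℕ}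
    (hf : ∀ n, f n = ((Nat.digits b n).map (· ^ e)).sum) (D a : ℕ) (ha : a < b) :
    ∃ j E, E = D + j ∧ j ≡ a [MOD (b-1)^e] ∧ f E = f D + a ^ e := by
  have hc : Nat.Coprime b ((b - 1) ^ e) := by
    apply Nat.Coprime.pow_right
    obtain ⟨q, rfl⟩ : ∃ q, b = q + 1 := ⟨b - 1, by omega⟩
    simp
  have hφ : 0 < Nat.totient ((b-1)^e) := Nat.totient_pos.2 (Nat.pow_pos (by omega))
  set φ := Nat.totient ((b-1)^e) with hφd
  refine ⟨b ^ (φ * D) * a, _, rfl, ?_, ?_⟩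
  · have h := (Nat.ModEq.pow_totient hc).pow D
    rw [← pow_mul, one_pow] at h
    simpa using h.mul_right a
  · rw [add_comm D, f_add hb he hf, f_digit hb he hf a ha, add_comm]
    calc D < b ^ D := Nat.lt_pow_self (by omega)
      _ ≤ _ := Nat.pow_le_pow_right (by omega) (by nlinarith)

theorem append {b e : ℕ} (hb : 2 ≤ b) (he : 1 ≤ e) {f : ℕ → ℕ}
    (hf : ∀ n, f n = ((Nat.digits b n).map (· ^ e)).sum) (D a : ℕ) (ha : a < b) (t : ℕ) :
    ∃ j, j ≡ t * a [MOD (b-1)^e] ∧ f (D + j) = f D + t * a ^ e := by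
  induction t with
  | zero => exact ⟨0, by simp [Nat.ModEq.refl], by simp⟩
  | succ t ih =>
    obtain ⟨j, h1, h2⟩ := ih
    obtain ⟨i, E, rfl, h3, h4⟩ := append1 hb he hf (D + j) a ha
    refine ⟨j + i, ?_, ?_⟩
    · rw [add_mul, one_mul]; exact h1.add h3
    · rw [← add_assoc, h4, h2]; ring

theorem find_j {b e : ℕ} (hb : 2 ≤ b) (he : 1 ≤ e)
    (hp : ∀ p : ℕ, p.Prime → p ∣ b - 1 → ¬ (p - 1 ∣ e - 1)) {f : ℕ → ℕ}
    (hf : ∀ n, f n = ((Nat.digits b n).map (· ^ e)).sum) (D : ℕ) :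
    ∃ j, b - 1 ∣ f (D + j * (b-1)^e) := by
  obtain ⟨g, hg, hu⟩ := exists_g (b-1) e (by omega) he hp
  haveI : NeZero (b - 1) := ⟨by omega⟩
  obtain ⟨w, hw⟩ := hu
  set t : ℕ := (-(f D : ZMod (b-1)) * ((w⁻¹ : (ZMod (b-1))ˣ) : ZMod (b-1))).val with ht
  have ht' : (t : ZMod (b-1)) = -(f D : ZMod (b-1)) * ((w⁻¹ : (ZMod (b-1))ˣ) : ZMod (b-1)) := by
    rw [ht, ZMod.natCast_zmod_val]
  have hQ : 1 ≤ (b-1)^e := Nat.one_le_pow _ _ (by omega)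
  obtain ⟨i, h1, h2⟩ := append hb he hf D g (by omega) t
  obtain ⟨k, h3, h4⟩ := append hb he hf (D + i) 1 (by omega) (t * g * ((b-1)^e - 1))
  have h5 : i + k ≡ 0 [MOD (b-1)^e] := by
    have := h1.add h3
    have e1 : t * g + t * g * ((b-1)^e - 1) * 1 = (t * g) * (b-1)^e := by
      obtain ⟨m, hm⟩ : ∃ m, (b-1)^e = m + 1 := ⟨(b-1)^e - 1, by omega⟩
      rw [hm, Nat.add_sub_cancel]; ring
    rw [e1] at this
    exact this.trans (by simp [Nat.ModEq])
  obtain ⟨j, hj⟩ := (Nat.modEq_zero_iff_dvd).1 h5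
  refine ⟨j, ?_⟩
  rw [mul_comm j, ← hj, ← add_assoc, h4, h2, ← ZMod.natCast_eq_zero_iff]
  have hq0 : ((b - 1 : ℕ) : ZMod (b-1)) = 0 := ZMod.natCast_self _
  push_cast [Nat.cast_sub hQ]
  rw [hq0, zero_pow (by omega)]
  have : (f D : ZMod (b-1)) + t * (g : ZMod (b-1)) ^ e + t * g * (0 - 1) * 1 ^ e
      = f D + t * ((g : ZMod (b-1)) ^ e - g) := by ring
  rw [this, ← hw, ht', mul_assoc, Units.inv_mul]
  ring

theorem merge1 {b e : ℕ} (hb : 2 ≤ b) (he : 1 ≤ e)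
    (hp : ∀ p : ℕ, p.Prime → p ∣ b - 1 → ¬ (p - 1 ∣ e - 1)) {f : ℕ → ℕ}
    (hf : ∀ n, f n = ((Nat.digits b n).map (· ^ e)).sum) (x d : ℕ) : Mg f x (x + d) := by
  rcases Nat.eq_zero_or_pos d with rfl | hd
  · exact ⟨0, 0, rfl⟩
  have hs : x + d < b ^ (x + d) := Nat.lt_pow_self (by omega)
  set s := x + d with hsd
  have hQ : 1 ≤ (b-1)^e := Nat.one_le_pow _ _ (by omega)
  obtain ⟨j, hj⟩ := find_j hb he hp hf (f (b ^ s - d) + ((b-1)^e - 1))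
  have hpos : 1 ≤ b ^ (j+1) := Nat.one_le_pow _ _ (by omega)
  have hle : b ^ s ≤ b ^ s * b ^ (j+1) := Nat.le_mul_of_pos_right _ hpos
  apply transfer hb he hf (b ^ s * b ^ (j+1) - s)
  have e1 : b ^ s * b ^ (j+1) - s + x = b ^ s * (b ^ (j+1) - 1) + (b ^ s - d) := by
    rw [Nat.mul_sub, mul_one]; omega
  have e2 : b ^ s * b ^ (j+1) - s + s = b ^ (s + (j + 1)) * 1 := by
    rw [pow_add b s (j + 1), mul_one]; exact Nat.sub_add_cancel (by omega)
  rw [e1, e2, f_mulb hb he hf, f_add hb he hf _ _ _ (by omega), f_nines hb he hf,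
    f_digit hb he hf 1 (by omega), one_pow]
  apply Mg.symm
  have := merge2 hb he hf 1 _ hj
  convert this using 1
  rw [add_mul]; omega

theorem const {b e : ℕ} (hb : 2 ≤ b) (he : 1 ≤ e)
    (hp : ∀ p : ℕ, p.Prime → p ∣ b - 1 → ¬ (p - 1 ∣ e - 1)) {f : ℕ → ℕ}
    (hf : ∀ n, f n = ((Nat.digits b n).map (· ^ e)).sum) (n : ℕ) :
    ∃ l r c, ∀ i ≤ n, f^[r] (l + i) = c := by
  induction n with
  | zero => exact ⟨0, 0, 0, by simp⟩
  | succ n ih =>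
    obtain ⟨l, r, c, h⟩ := ih
    have hm : Mg f c (f^[r] (l + (n+1))) := by
      rcases le_total c (f^[r] (l + (n+1))) with h1 | h1
      · obtain ⟨d, hd⟩ := Nat.exists_eq_add_of_le h1
        rw [hd]; exact merge1 hb he hp hf _ _
      · obtain ⟨d, hd⟩ := Nat.exists_eq_add_of_le h1
        apply Mg.symm
        rw [hd]; exact merge1 hb he hp hf _ _
    obtain ⟨k, s, hks⟩ := hm
    obtain ⟨m, hm⟩ := shift hb he hf r k (l + (n+1))
    refine ⟨m + l, s + r, f^[s] (k + c), fun i hi => ?_⟩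
    rw [Function.iterate_add_apply, add_assoc, hm _ (by omega)]
    rcases Nat.lt_or_ge n i with h1 | h1
    · obtain rfl : i = n + 1 := by omega
      exact hks.symm
    · rw [h i h1]

end

end DigMap

/-- For the `(e,b)` digit map (with `p - 1 ∤ e - 1` for all primes
`p ∣ b - 1`), any cycle number `u` admits arbitrarily long runs of consecutive
`u`-integers. -/
theorem stmt_13 (b e : ℕ) (hb : 2 ≤ b) (he : 1 ≤ e)
    (hp : ∀ p : ℕ, p.Prime → p ∣ b - 1 → ¬ (p - 1 ∣ e - 1))
    (f : ℕ → ℕ) (hf : ∀ n, f n = ((Nat.digits b n).map (· ^ e)).sum)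
    (u : ℕ) (hu : 0 < u) (hcyc : ∃ r : ℕ, 1 ≤ r ∧ f^[r] u = u)
    (n : ℕ) (hn : 0 < n) :
    ∃ l : ℕ, 0 < l ∧ ∀ i : ℕ, 1 ≤ i → i ≤ n → ∃ r : ℕ, 1 ≤ r ∧ f^[r] (l + i) = u := by
  obtain ⟨l, r, c, h⟩ := DigMap.const hb he hp hf (n+1)
  obtain ⟨R, hR, -⟩ := DigMap.ones hb he hf u
  have hR0 : 1 ≤ R := by
    rcases Nat.eq_zero_or_pos R with rfl | h0
    · rw [DigMap.f_zero hf] at hR; omega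
    · exact h0
  have hc : c < b ^ c := Nat.lt_pow_self (by omega)
  have hc2 : b ^ c ≤ b ^ c * R := Nat.le_mul_of_pos_right _ hR0
  obtain ⟨m, hm⟩ := DigMap.shift hb he hf r (b ^ c * R - c) (l + (n+1))
  refine ⟨m + l + 1, by omega, fun i _ hi => ⟨r + 1, by omega, ?_⟩⟩
  rw [Function.iterate_succ_apply', show m + l + 1 + i = m + (l + (i+1)) by ring,
    hm _ (by omega), h _ (by omega), Nat.sub_add_cancel (by omega), DigMap.f_mulb hb he hf, hR]
end

section
/- Fix integers b ≥ 2 and e ≥ 1 such that for every prime p dividing b - 1, p - 1 does not divide e - 1. Then there exist arbitrarily long sequences of consecutive (e,b)-happy numbers: for every positive integer n, there exists a positive integer l such that for each 1 ≤ i ≤ n, there is some r ≥ 1 with f^r(l+i) = 1, where f is the (e,b) digit map. -/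
def dmap (b e n : ℕ) : ℕ := ((Nat.digits b n).map (· ^ e)).sum

theorem dmap_zero (b e : ℕ) : dmap b e 0 = 0 := by simp [dmap]

theorem dmap_step (b e n : ℕ) (hb : 2 ≤ b) (he : 1 ≤ e) :
    dmap b e n = (n % b) ^ e + dmap b e (n / b) := by
  rcases Nat.eq_zero_or_pos n with rfl | h
  · simp [dmap, show e ≠ 0 by omega]
  · unfold dmap
    rw [Nat.digits_def' (by omega) h]; simp

theorem dmap_lt (b e a : ℕ) (hb : 2 ≤ b) (he : 1 ≤ e) (ha : a < b) : dmap b e a = a ^ e := by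
  rw [dmap_step b e a hb he, Nat.mod_eq_of_lt ha, Nat.div_eq_of_lt ha, dmap_zero, add_zero]

theorem dmap_add (b e : ℕ) (hb : 2 ≤ b) (he : 1 ≤ e) (k : ℕ) : ∀ u v : ℕ, u < b ^ k →
    dmap b e (u + b ^ k * v) = dmap b e u + dmap b e v := by
  induction k with
  | zero => intro u v hu; simp at hu; subst hu; simp [dmap_zero]
  | succ k ih =>
    intro u v hu
    have hb0 : 0 < b := by omega
    rw [dmap_step b e (u + _) hb he, dmap_step b e u hb he]
    have e1 : u + b ^ (k + 1) * v = u + b * (b ^ k * v) := by ring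
    have hu' : u / b < b ^ k := by
      rw [Nat.div_lt_iff_lt_mul hb0, ← pow_succ]; exact hu
    rw [e1, Nat.add_mul_mod_self_left, Nat.add_mul_div_left _ _ hb0, ih _ _ hu', add_assoc]

theorem dmap_mul (b e : ℕ) (hb : 2 ≤ b) (he : 1 ≤ e) (k v : ℕ) :
    dmap b e (b ^ k * v) = dmap b e v := by
  have := dmap_add b e hb he k 0 v (by positivity)
  simpa [dmap_zero] using this

theorem dmap_one (b e : ℕ) (hb : 2 ≤ b) (he : 1 ≤ e) : dmap b e 1 = 1 := by
  rw [dmap_lt b e 1 hb he (by omega)]; simp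

theorem dmap_pow (b e : ℕ) (hb : 2 ≤ b) (he : 1 ≤ e) (k : ℕ) : dmap b e (b ^ k) = 1 := by
  have := dmap_mul b e hb he k 1
  rwa [mul_one, dmap_one b e hb he] at this

theorem dmap_pow_sub_one (b e : ℕ) (hb : 2 ≤ b) (he : 1 ≤ e) (j : ℕ) :
    dmap b e (b ^ j - 1) = j * (b - 1) ^ e := by
  induction j with
  | zero => simp [dmap_zero]
  | succ j ih =>
    have hpos : 0 < b ^ j := by positivity
    have e1 : b ^ (j + 1) - 1 = (b ^ j - 1) + b ^ j * (b - 1) := by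
      obtain ⟨c, rfl⟩ : ∃ c, b = c + 1 := ⟨b - 1, by omega⟩
      rw [pow_succ, mul_add]; simp only [Nat.add_sub_cancel]; omega
    rw [e1, dmap_add b e hb he j _ _ (by omega), ih, dmap_lt b e (b - 1) hb he (by omega)]
    ring

theorem dmap_surj (b e : ℕ) (hb : 2 ≤ b) (he : 1 ≤ e) (h : ℕ) : ∃ v, dmap b e v = h := by
  induction h with
  | zero => exact ⟨0, dmap_zero b e⟩
  | succ h ih =>
    obtain ⟨v, hv⟩ := ih
    refine ⟨1 + b ^ 1 * v, ?_⟩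
    rw [dmap_add b e hb he 1 1 v (by simp; omega), dmap_one b e hb he, hv]; ring

/-- density predicate -/
def Reach (b e : ℕ) (u v : ℤ) : Prop := ∀ B : ℕ, ∃ D : ℕ, B ≤ D ∧
  (D : ℤ) ≡ u [ZMOD ((b - 1 : ℕ) ^ e : ℕ)] ∧ (dmap b e D : ℤ) ≡ v [ZMOD (b - 1 : ℕ)]

theorem pow_big (b e : ℕ) (hb : 2 ≤ b) (B : ℕ) :
    ∃ K : ℕ, B < b ^ K ∧ ((b ^ K : ℕ) : ℤ) ≡ 1 [ZMOD ((b - 1 : ℕ) ^ e : ℕ)] := by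
  have hco : Nat.Coprime b ((b - 1) ^ e) := by
    apply Nat.Coprime.pow_right
    obtain ⟨c, rfl⟩ : ∃ c, b = c + 1 := ⟨b - 1, by omega⟩
    simp
  have h0 : 0 < (b - 1) ^ e := Nat.pow_pos (by omega)
  have hphi := Nat.totient_pos.2 h0
  refine ⟨Nat.totient ((b - 1) ^ e) * B, ?_, ?_⟩
  · calc B < b ^ B := Nat.lt_pow_self (by omega)
      _ ≤ _ := Nat.pow_le_pow_right (by omega) (Nat.le_mul_of_pos_left _ hphi)
  · have := (Nat.ModEq.pow_totient hco).pow B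
    rw [← pow_mul, one_pow] at this
    exact_mod_cast (Int.natCast_modEq_iff.2 this)

theorem Reach.add {b e : ℕ} (hb : 2 ≤ b) (he : 1 ≤ e) {u v u' v' : ℤ}
    (h : Reach b e u v) (h' : Reach b e u' v') : Reach b e (u + u') (v + v') := by
  intro B
  obtain ⟨D, h1, h2, h3⟩ := h B
  obtain ⟨D', h1', h2', h3'⟩ := h' 0
  obtain ⟨K, hK, hK1⟩ := pow_big b e hb D
  refine ⟨D + b ^ K * D', by omega, ?_, ?_⟩
  · have := h2.add (hK1.mul h2')
    rw [one_mul] at this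
    exact_mod_cast this
  · rw [dmap_add b e hb he K _ _ hK]
    exact_mod_cast h3.add h3'

theorem Reach.base {b e : ℕ} (hb : 2 ≤ b) (he : 1 ≤ e) {a : ℕ} (ha : 1 ≤ a) (hab : a < b) :
    Reach b e a ((a : ℤ) ^ e) := by
  intro B
  obtain ⟨K, hK, hK1⟩ := pow_big b e hb B
  refine ⟨b ^ K * a, by nlinarith, ?_, ?_⟩
  · have := hK1.mul_right (a : ℤ)
    rw [one_mul] at this
    exact_mod_cast this
  · rw [dmap_mul b e hb he, dmap_lt b e a hb he hab]; push_cast; rfl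

theorem Reach.smul {b e : ℕ} (hb : 2 ≤ b) (he : 1 ≤ e) {u v : ℤ}
    (h : Reach b e u v) (n : ℕ) : Reach b e ((n + 1 : ℕ) * u) ((n + 1 : ℕ) * v) := by
  induction n with
  | zero => simpa using h
  | succ n ih =>
    have := ih.add hb he h
    convert this using 1 <;> push_cast <;> ring

theorem Reach.congr {b e : ℕ} {u v u' v' : ℤ} (h : Reach b e u v)
    (hu : u ≡ u' [ZMOD ((b - 1 : ℕ) ^ e : ℕ)]) (hv : v ≡ v' [ZMOD (b - 1 : ℕ)]) :
    Reach b e u' v' := by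
  intro B
  obtain ⟨D, h1, h2, h3⟩ := h B
  exact ⟨D, h1, h2.trans hu, h3.trans hv⟩

/-- negation -/
theorem Reach.neg {b e : ℕ} (hb : 2 ≤ b) (he : 1 ≤ e) {u v : ℤ}
    (h : Reach b e u v) : Reach b e (-u) (-v) := by
  have h0 : 0 < (b - 1) ^ e := Nat.pow_pos (by omega)
  have hd : (b - 1) ∣ (b - 1) ^ e := dvd_pow_self _ (by omega)
  obtain ⟨q, hq⟩ := hd
  have h1 := h.smul hb he (2 * (b - 1) ^ e - 2)
  have e1 : ((2 * (b - 1) ^ e - 2 + 1 : ℕ) : ℤ) = 2 * (((b - 1) ^ e : ℕ) : ℤ) - 1 := by omega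
  rw [e1] at h1
  refine h1.congr ?_ ?_
  · rw [Int.modEq_iff_dvd]; exact ⟨-2 * u, by ring⟩
  · rw [Int.modEq_iff_dvd, hq]; exact ⟨-2 * q * v, by push_cast; ring⟩

theorem reach_zero {b e : ℕ} (hb : 2 ≤ b) (he : 1 ≤ e)
    (hp : ∀ p : ℕ, p.Prime → p ∣ b - 1 → ¬ (p - 1 ∣ e - 1)) (c : ℤ) : Reach b e c 0 := by
  have h11 : Reach b e 1 1 := by simpa using Reach.base hb he (le_refl 1) (by omega : 1 < b)
  have h00 : Reach b e 0 0 := by simpa using h11.add hb he (h11.neg hb he)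
  let I : AddSubgroup (ℤ × ℤ) :=
    { carrier := {x | Reach b e x.1 x.2}
      zero_mem' := h00
      add_mem' := fun {x y} hx hy => Reach.add hb he hx hy
      neg_mem' := fun {x} hx => Reach.neg hb he hx }
  let J : AddSubgroup ℤ := I.comap (AddMonoidHom.inr ℤ ℤ)
  have hJ : ∀ v, v ∈ J ↔ Reach b e 0 v := fun v => Iff.rfl
  have hdiag : ∀ n : ℤ, Reach b e n n := by
    intro n
    have : n • ((1 : ℤ), (1 : ℤ)) ∈ I := I.zsmul_mem h11 n
    simpa [I] using this
  obtain ⟨g, hg⟩ := Int.subgroup_cyclic J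
  rw [← AddSubgroup.zmultiples_eq_closure] at hg
  have hdvd : ∀ v, Reach b e 0 v → g ∣ v := by
    intro v hv
    have := (hJ v).2 hv
    rw [hg] at this
    exact Int.mem_zmultiples_iff.1 this
  have hgu : g.natAbs = 1 := by
    by_contra hne
    obtain ⟨p, pp, hpg⟩ := Nat.exists_prime_and_dvd hne
    have hpg' : (p : ℤ) ∣ g := Int.natCast_dvd.2 hpg
    have hpb : p ∣ b - 1 := by
      have : g ∣ ((b - 1 : ℕ) : ℤ) := hdvd _ (h00.congr rfl (by
        rw [Int.modEq_iff_dvd]; simp))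
      exact_mod_cast hpg'.trans this
    apply hp p pp hpb
    haveI := Fact.mk pp
    have hle : p ≤ b - 1 := Nat.le_of_dvd (by omega) hpb
    have key : ∀ x : (ZMod p)ˣ, x ^ (e - 1) = 1 := by
      intro x
      have hx0 : (x : ZMod p) ≠ 0 := x.ne_zero
      have hlt := ZMod.val_lt (x : ZMod p)
      have hpos : 1 ≤ (x : ZMod p).val := by
        rw [Nat.one_le_iff_ne_zero]; simpa [ZMod.val_eq_zero] using hx0
      have h1 := Reach.base hb he hpos (by omega : (x : ZMod p).val < b)
      have h2 := h1.add hb he (hdiag (-((x : ZMod p).val : ℤ)))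
      rw [add_neg_cancel] at h2
      have h3 := hpg'.trans (hdvd _ h2)
      have h4 := (ZMod.intCast_zmod_eq_zero_iff_dvd _ p).2 h3
      push_cast at h4
      rw [ZMod.natCast_zmod_val] at h4
      have h5 : (x : ZMod p) * x ^ (e - 1) = x * 1 := by
        rw [← pow_succ', Nat.sub_add_cancel he, mul_one]; linear_combination h4
      have h6 := mul_left_cancel₀ hx0 h5
      ext; push_cast; exact h6
    have := (FiniteField.forall_pow_eq_one_iff (ZMod p) (e - 1)).1 key
    rwa [ZMod.card] at this
  have hall : ∀ v, Reach b e 0 v := by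
    intro v
    rw [← hJ, hg]
    exact Int.mem_zmultiples_iff.2 ((Int.isUnit_iff_natAbs_eq.2 hgu).dvd)
  simpa using (hdiag c).add hb he (hall (-c))

theorem merge_mod {b e : ℕ} (hb : 2 ≤ b) (he : 1 ≤ e) (x y : ℕ) (hxy : x ≤ y)
    (h : b - 1 ∣ y - x) : ∃ t, dmap b e (x + t) = dmap b e (y + t) := by
  obtain ⟨c, hc⟩ := h
  have hK : c * b + x < b ^ (c * b + x) := Nat.lt_pow_self (by omega)
  set K := c * b + x
  have hcb : c ≤ c * b := Nat.le_mul_of_pos_right _ (by omega)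
  have hcb' : c * b = (b - 1) * c + c := by
    obtain ⟨d, rfl⟩ : ∃ d, b = d + 1 := ⟨b - 1, by omega⟩
    simp; ring
  refine ⟨c + b ^ K * 1 - x, ?_⟩
  rw [show x + (c + b ^ K * 1 - x) = c + b ^ K * 1 by omega,
    show y + (c + b ^ K * 1 - x) = b ^ 1 * c + b ^ K * 1 by rw [pow_one, mul_comm b c]; omega,
    dmap_add b e hb he K _ _ (by omega),
    dmap_add b e hb he K _ _ (by rw [pow_one, mul_comm b c]; omega), dmap_mul b e hb he]

theorem merge {b e : ℕ} (hb : 2 ≤ b) (he : 1 ≤ e)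
    (hp : ∀ p : ℕ, p.Prime → p ∣ b - 1 → ¬ (p - 1 ∣ e - 1)) (x y : ℕ) (hxy : x < y) :
    ∃ t1 t2 t3, dmap b e (dmap b e (dmap b e (x + t1) + t2) + t3)
      = dmap b e (dmap b e (dmap b e (y + t1) + t2) + t3) := by
  have hK : y < b ^ y := Nat.lt_pow_self (by omega)
  set P := b ^ y with hP
  set c := dmap b e (P - (y - x)) with hc
  have hpos : 0 < (b - 1) ^ e := Nat.pow_pos (by omega)
  obtain ⟨D, hD, hD1, hD2⟩ := reach_zero hb he hp ((c : ℤ) - 1) c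
  obtain ⟨j, hj⟩ : ∃ j : ℕ, D + 1 = c + j * (b - 1) ^ e := by
    obtain ⟨q, hq⟩ := (Int.modEq_iff_dvd.1 hD1.symm)
    refine ⟨q.toNat, ?_⟩
    have hq0 : 0 ≤ q := by
      by_contra hneg
      have : (((b - 1) ^ e : ℕ) : ℤ) * q < 0 := mul_neg_of_pos_of_neg (by exact_mod_cast hpos) (by omega)
      omega
    zify
    rw [Int.toNat_of_nonneg hq0]
    push_cast at hq
    linarith
  have hPj : 0 < b ^ j := by positivity
  have hPle : P ≤ P * b ^ j := Nat.le_mul_of_pos_right _ hPj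
  have hy1 : dmap b e (y + (P * b ^ j - y)) = 1 := by
    rw [show y + (P * b ^ j - y) = b ^ (y + j) by rw [pow_add, ← hP]; omega]
    exact dmap_pow b e hb he _
  have hx1 : dmap b e (x + (P * b ^ j - y)) = D + 1 := by
    rw [show x + (P * b ^ j - y) = (P - (y - x)) + P * (b ^ j - 1) by
      rw [Nat.mul_sub, mul_one]; omega, hP, dmap_add b e hb he y _ _ (by omega),
      dmap_pow_sub_one b e hb he, ← hP, ← hc, hj]
  have hDlt : D < b ^ D := Nat.lt_pow_self (by omega)
  have hy2 : dmap b e (1 + (b ^ D - 1)) = 1 := by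
    rw [show 1 + (b ^ D - 1) = b ^ D by omega]; exact dmap_pow b e hb he _
  have hx2 : dmap b e (D + 1 + (b ^ D - 1)) = dmap b e D + 1 := by
    rw [show D + 1 + (b ^ D - 1) = D + b ^ D * 1 by omega, dmap_add b e hb he D _ _ hDlt,
      dmap_one b e hb he]
  obtain ⟨t, ht⟩ := merge_mod (e := e) hb he 1 (dmap b e D + 1) (by omega) (by
    have := Int.modEq_zero_iff_dvd.1 hD2
    simpa using (Int.natCast_dvd_natCast.1 this))
  refine ⟨P * b ^ j - y, b ^ D - 1, t, ?_⟩
  rw [hy1, hx1, hy2, hx2, ht]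

def GoodSet (b e : ℕ) (S : Finset ℕ) : Prop :=
  ∃ h : ℕ, 0 < h ∧ ∀ s ∈ S, ∃ r : ℕ, 1 ≤ r ∧ (dmap b e)^[r] (h + s) = 1

theorem good_image {b e : ℕ} (hb : 2 ≤ b) (he : 1 ≤ e) (S : Finset ℕ) (t : ℕ)
    (h : GoodSet b e (S.image (fun s => dmap b e (s + t)))) : GoodSet b e S := by
  obtain ⟨h, h0, hh⟩ := h
  obtain ⟨v, hv⟩ := dmap_surj b e hb he h
  have hv0 : 0 < v := by
    rcases Nat.eq_zero_or_pos v with rfl | h'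
    · rw [dmap_zero] at hv; omega
    · exact h'
  set K := S.sup id + t
  have hK : K < b ^ K := Nat.lt_pow_self (by omega)
  refine ⟨t + b ^ K * v, by positivity, fun s hs => ?_⟩
  obtain ⟨r, hr, hr'⟩ := hh _ (Finset.mem_image_of_mem _ hs)
  have hsS : s ≤ S.sup id := Finset.le_sup (f := id) hs
  refine ⟨r + 1, by omega, ?_⟩
  rw [Function.iterate_succ_apply, show t + b ^ K * v + s = (s + t) + b ^ K * v by ring,
    dmap_add b e hb he K _ _ (by omega), hv, add_comm]
  exact hr'

theorem good_all {b e : ℕ} (hb : 2 ≤ b) (he : 1 ≤ e)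
    (hp : ∀ p : ℕ, p.Prime → p ∣ b - 1 → ¬ (p - 1 ∣ e - 1)) (n : ℕ) :
    ∀ S : Finset ℕ, S.card = n → GoodSet b e S := by
  induction n using Nat.strong_induction_on with
  | _ n ih =>
    intro S hS
    by_cases h1 : S.card ≤ 1
    · obtain ⟨a, ha⟩ := Finset.card_le_one_iff_subset_singleton.1 h1
      have hK : a < b ^ a := Nat.lt_pow_self (by omega)
      refine ⟨b ^ a - a, by omega, fun s hs => ⟨1, le_refl _, ?_⟩⟩
      have := Finset.mem_singleton.1 (ha hs)
      subst this
      rw [Function.iterate_one, Nat.sub_add_cancel hK.le]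
      exact dmap_pow b e hb he _
    · obtain ⟨x, hx, y, hy, hne⟩ := Finset.one_lt_card.1 (not_le.1 h1)
      obtain ⟨t1, t2, t3, ht⟩ : ∃ t1 t2 t3, dmap b e (dmap b e (dmap b e (x + t1) + t2) + t3)
          = dmap b e (dmap b e (dmap b e (y + t1) + t2) + t3) := by
        rcases lt_or_gt_of_ne hne with h | h
        · exact merge hb he hp x y h
        · obtain ⟨t1, t2, t3, ht⟩ := merge hb he hp y x h
          exact ⟨t1, t2, t3, ht.symm⟩
      apply good_image hb he S t1
      apply good_image hb he _ t2
      apply good_image hb he _ t3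
      refine ih _ ?_ _ rfl
      rw [Finset.image_image, Finset.image_image, ← hS]
      refine lt_of_le_of_ne Finset.card_image_le fun hc => hne ?_
      exact Finset.card_image_iff.1 hc hx hy ht

/-- There exist arbitrarily long sequences of consecutive
`(e,b)`-happy numbers, assuming `p - 1 ∤ e - 1` for every prime `p ∣ b - 1`. -/
theorem stmt_14 (b e : ℕ) (hb : 2 ≤ b) (he : 1 ≤ e)
    (hp : ∀ p : ℕ, p.Prime → p ∣ b - 1 → ¬ (p - 1 ∣ e - 1))
    (f : ℕ → ℕ) (hf : ∀ n, f n = ((Nat.digits b n).map (· ^ e)).sum)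
    (n : ℕ) (hn : 0 < n) :
    ∃ l : ℕ, 0 < l ∧ ∀ i : ℕ, 1 ≤ i → i ≤ n → ∃ r : ℕ, 1 ≤ r ∧ f^[r] (l + i) = 1 := by
  have hfd : f = dmap b e := funext hf
  subst hfd
  obtain ⟨h, h0, hh⟩ := good_all hb he hp _ (Finset.Icc 1 n) rfl
  exact ⟨h, h0, fun i h1 h2 => hh i (Finset.mem_Icc.2 ⟨h1, h2⟩)⟩
end

section
/- There are arbitrarily large gaps in the sequence of (2,10)-happy numbers: for every positive integer n, there exists a positive integer l such that none of l+1, l+2, ..., l+n is a (2,10)-happy number, i.e., for each 1 ≤ i ≤ n there is no r ≥ 1 with f^r(l+i) = 1, where f is the (2,10) digit map. -/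
def hF (n : ℕ) : ℕ := ((Nat.digits 10 n).map (· ^ 2)).sum

def hU (x : ℕ) : Prop := ∀ r : ℕ, hF^[r] x ≠ 1

def hGood (D : ℕ → Prop) : Prop := ∃ s : ℕ, 0 < s ∧ ∀ d, D d → hU (s + d)

lemma hF_step (n : ℕ) : hF n = (n % 10) ^ 2 + hF (n / 10) := by
  rcases Nat.eq_zero_or_pos n with h | h
  · subst h; simp [hF]
  · unfold hF
    rw [Nat.digits_def' (by norm_num) h]
    simp

lemma hU_of_F (x : ℕ) (h : hU (hF x)) : hU x := by
  intro r hr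
  cases r with
  | zero =>
    have hx : x = 1 := hr
    subst hx
    exact h 0 (by decide +kernel)
  | succ r => exact h r hr

lemma hU_four : hU 4 := by
  intro r
  have key : hF^[r] 4 ∈ ([4, 16, 37, 58, 89, 145, 42, 20] : List ℕ) := by
    induction r with
    | zero => simp
    | succ r ih =>
      rw [Function.iterate_succ_apply']
      have : ∀ y ∈ ([4, 16, 37, 58, 89, 145, 42, 20] : List ℕ),
          hF y ∈ ([4, 16, 37, 58, 89, 145, 42, 20] : List ℕ) := by decide +kernel
      exact this _ ih
  intro h
  rw [h] at key
  simp at key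

lemma hU_of_iter (k x : ℕ) (h : hF^[k] x = 4) : hU x := by
  induction k generalizing x with
  | zero => have hx : x = 4 := h
            subst hx; exact hU_four
  | succ k ih => exact hU_of_F x (ih _ h)

lemma hF_split (m a b : ℕ) (hb : b < 10 ^ m) : hF (10 ^ m * a + b) = hF a + hF b := by
  induction m generalizing b with
  | zero =>
    have : b = 0 := by simpa using hb
    subst this; simp [hF]
  | succ m ih =>
    rw [hF_step, hF_step b]
    have e : 10 ^ (m + 1) * a + b = 10 * (10 ^ m * a) + b := by ring
    have h1 : (10 ^ (m + 1) * a + b) % 10 = b % 10 := by rw [e]; omega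
    have h2 : (10 ^ (m + 1) * a + b) / 10 = 10 ^ m * a + b / 10 := by rw [e]; omega
    rw [h1, h2, ih]
    · ring
    · rw [pow_succ] at hb; omega

lemma h_ones (T : ℕ) : ∃ a, T ≤ a ∧ hF a = T := by
  induction T with
  | zero => exact ⟨0, le_rfl, by simp [hF]⟩
  | succ T ih =>
    obtain ⟨a, h1, h2⟩ := ih
    refine ⟨10 * a + 1, by omega, ?_⟩
    rw [hF_step, show (10 * a + 1) % 10 = 1 by omega, show (10 * a + 1) / 10 = a by omega, h2]
    ring

lemma hGood_step (D E : ℕ → Prop) (m c : ℕ) (hD : ∀ d, D d → c + d < 10 ^ m)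
    (hE : ∀ d, D d → E (hF (c + d))) (h : hGood E) : hGood D := by
  obtain ⟨T, hT, hs⟩ := h
  obtain ⟨a, ha, hFa⟩ := h_ones T
  refine ⟨10 ^ m * a + c, ?_, fun d hd => ?_⟩
  · have : 0 < 10 ^ m * a := Nat.mul_pos (by positivity) (by omega)
    omega
  · apply hU_of_F
    rw [add_assoc, hF_split m a _ (hD d hd), hFa]
    exact hs _ (hE d hd)

lemma hF_le (k d : ℕ) (h : d < 10 ^ k) : hF d ≤ 81 * k := by
  induction k generalizing d with
  | zero =>
    have : d = 0 := by simpa using h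
    subst this; simp [hF]
  | succ k ih =>
    rw [hF_step]
    have := ih (d / 10) (by rw [pow_succ] at h; omega)
    have h9 : d % 10 ≤ 9 := by omega
    have : (d % 10) ^ 2 ≤ 9 ^ 2 := Nat.pow_le_pow_left h9 2
    omega

lemma hGood_base : hGood (fun d => d < 244) := by
  apply hGood_step _ (fun e => ∃ d < 244, e = hF (753 + d)) 4 753 (fun d hd => by norm_num; omega)
    (fun d hd => ⟨d, hd, rfl⟩)
  apply hGood_step _ (fun e => ∃ d < 244, e = hF (163 + hF (753 + d))) 4 163
  · rintro e ⟨d, hd, rfl⟩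
    have := hF_le 4 (753 + d) (by norm_num; omega)
    norm_num; omega
  · rintro e ⟨d, hd, rfl⟩
    exact ⟨d, hd, rfl⟩
  refine ⟨79, by norm_num, ?_⟩
  rintro e ⟨d, hd, rfl⟩
  have key : ∀ d < 244, ∃ k < 20, hF^[k] (79 + hF (163 + hF (753 + d))) = 4 := by
    decide +kernel
  obtain ⟨k, -, hk⟩ := key d hd
  exact hU_of_iter k _ hk

lemma hGood_mono (a b : ℕ) (hab : a ≤ b) (h : hGood (fun d => d < b)) :
    hGood (fun d => d < a) := by
  obtain ⟨s, hs, hh⟩ := h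
  exact ⟨s, hs, fun d hd => hh d (lt_of_lt_of_le hd hab)⟩

lemma h_pow (k : ℕ) : 81 * (k + 4) + 1 ≤ 10 ^ (k + 3) := by
  induction k with
  | zero => norm_num
  | succ k ih => rw [show k + 1 + 3 = (k + 3) + 1 by ring, pow_succ]; omega

lemma hGood_pow (k : ℕ) : hGood (fun d => d < 10 ^ (k + 3)) := by
  induction k with
  | zero =>
    refine hGood_step _ (fun d => d < 244) 3 0 (fun d hd => by simpa using hd) (fun d hd => ?_)
      hGood_base
    have := hF_le 3 d hd
    rw [zero_add]; omega
  | succ k ih =>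
    refine hGood_step _ (fun d => d < 81 * (k + 4) + 1) (k + 4) 0
      (fun d hd => by rw [zero_add]; exact hd) (fun d hd => ?_) (hGood_mono _ _ (h_pow k) ih)
    have := hF_le (k + 4) d hd
    rw [zero_add]; omega

/-- There are arbitrarily large gaps in the sequence of
`(2,10)`-happy numbers. -/
theorem stmt_15 (f : ℕ → ℕ)
    (hf : ∀ n, f n = ((Nat.digits 10 n).map (· ^ 2)).sum)
    (n : ℕ) (hn : 0 < n) :
    ∃ l : ℕ, 0 < l ∧ ∀ i : ℕ, 1 ≤ i → i ≤ n →
      ¬ ∃ r : ℕ, 1 ≤ r ∧ f^[r] (l + i) = 1 := by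
  have hfF : f = hF := funext hf
  subst hfF
  obtain ⟨s, hs, h⟩ := hGood_pow n
  refine ⟨s, hs, fun i _ hi => ?_⟩
  rintro ⟨r, -, hr⟩
  refine h i ?_ r hr
  have : n + 3 < 10 ^ (n + 3) := Nat.lt_pow_self (by norm_num)
  show i < 10 ^ (n + 3)
  omega
end
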